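/- arXiv:1811.04744 — 2 statements merged into one kernel-verified Lean document; each statement's English description precedes it below -/
import Mathlib

section
/- Let α > 0 and β ∈ ℝ satisfy 2α + 3β ≥ 0, let q ∈ (1,∞), and let k ∈ ℕ. Define the Lamé operator L by (Lu)(x) = −α·Δu(x) − (α+β)·∇(div u)(x) for u : ℝ³ → ℝ³. There exists a constant C > 0, depending only on α, β, q and k, such that for every Schwartz function u : ℝ³ → ℝ³ one has ‖∇^{k+2} u‖_{L^q(ℝ³)} ≤ C · ‖∇^k(Lu)‖_{L^q(ℝ³)}. -/
open MeasureTheory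

/-- The Lamé operator `Lu = -α Δu - (α+β) ∇(div u)` on vector fields on `ℝ³`. -/
noncomputable def lameOp (α β : ℝ)
    (u : EuclideanSpace ℝ (Fin 3) → EuclideanSpace ℝ (Fin 3))
    (x : EuclideanSpace ℝ (Fin 3)) : EuclideanSpace ℝ (Fin 3) :=
  (-α) • (∑ j : Fin 3, iteratedFDeriv ℝ 2 u x (fun _ => EuclideanSpace.single j 1))
    - (α + β) •
      gradient (fun y => ∑ i : Fin 3, fderiv ℝ u y (EuclideanSpace.single i 1) i) x

/-- A `C²` function of two real variables, bundled with its partial derivatives, which has its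
minimum at the origin and whose Hessian dominates some form `τ a² + τ⁻¹ b²`, `τ > 0`,
at every point. -/
structure BellmanFunction where
  /-- the function -/
  toFun : ℝ → ℝ → ℝ
  /-- first partial derivative in the first variable -/
  dx : ℝ → ℝ → ℝ
  /-- first partial derivative in the second variable -/
  dy : ℝ → ℝ → ℝ
  /-- second partial derivative in the first variable -/
  dxx : ℝ → ℝ → ℝ
  /-- mixed partial derivative -/
  dxy : ℝ → ℝ → ℝ
  /-- second partial derivative in the second variable -/
  dyy : ℝ → ℝ → ℝ
  hasDerivAt_toFun : ∀ {u v : ℝ → ℝ} {u' v' t : ℝ}, HasDerivAt u u' t → HasDerivAt v v' t →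
    HasDerivAt (fun s => toFun (u s) (v s)) (dx (u t) (v t) * u' + dy (u t) (v t) * v') t
  hasDerivAt_dx : ∀ {u v : ℝ → ℝ} {u' v' t : ℝ}, HasDerivAt u u' t → HasDerivAt v v' t →
    HasDerivAt (fun s => dx (u s) (v s)) (dxx (u t) (v t) * u' + dxy (u t) (v t) * v') t
  hasDerivAt_dy : ∀ {u v : ℝ → ℝ} {u' v' t : ℝ}, HasDerivAt u u' t → HasDerivAt v v' t →
    HasDerivAt (fun s => dy (u s) (v s)) (dxy (u t) (v t) * u' + dyy (u t) (v t) * v') t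
  continuous_toFun : Continuous fun z : ℝ × ℝ => toFun z.1 z.2
  continuous_dx : Continuous fun z : ℝ × ℝ => dx z.1 z.2
  continuous_dy : Continuous fun z : ℝ × ℝ => dy z.1 z.2
  continuous_dxx : Continuous fun z : ℝ × ℝ => dxx z.1 z.2
  continuous_dxy : Continuous fun z : ℝ × ℝ => dxy z.1 z.2
  continuous_dyy : Continuous fun z : ℝ × ℝ => dyy z.1 z.2
  zero_le : ∀ x y, toFun 0 0 ≤ toFun x y
  coercive : ∀ x y, ∃ τ : ℝ, 0 < τ ∧ ∀ a b,
    τ * a ^ 2 + τ⁻¹ * b ^ 2 ≤ dxx x y * a ^ 2 + 2 * dxy x y * (a * b) + dyy x y * b ^ 2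

namespace BellmanFunction

lemma quadratic_form_lower_bound {τ σ X Y Z c : ℝ} (hτ : 0 < τ) (hσ : τ * σ = 1)
    (hX : 2 * τ ≤ X) (hY : |Y| ≤ c) (hZ : (c ^ 2 + 1) * σ ≤ Z) (a b : ℝ) :
    τ * a ^ 2 + σ * b ^ 2 ≤ X * a ^ 2 + 2 * Y * (a * b) + Z * b ^ 2 := by
  have hY2 : Y ^ 2 ≤ c ^ 2 := sq_le_sq' (by linarith [(abs_le.1 hY).1]) (abs_le.1 hY).2
  have hσ0 : 0 < σ := by
    by_contra! h
    nlinarith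
  have key : 0 ≤ τ * (a + σ * Y * b) ^ 2 := by positivity
  have e : τ * (a + σ * Y * b) ^ 2 =
      τ * a ^ 2 + 2 * Y * (a * b) * (τ * σ) + (τ * σ) * σ * Y ^ 2 * b ^ 2 := by ring
  rw [e, hσ] at key
  have h1 : σ * (Y ^ 2 * b ^ 2) ≤ σ * (c ^ 2 * b ^ 2) := by gcongr
  have h2 := mul_le_mul_of_nonneg_right hX (sq_nonneg a)
  have h3 := mul_le_mul_of_nonneg_right hZ (sq_nonneg b)
  nlinarith

/-- Exchange of the two variables. -/
def swap (B : BellmanFunction) : BellmanFunction where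
  toFun x y := B.toFun y x
  dx x y := B.dy y x
  dy x y := B.dx y x
  dxx x y := B.dyy y x
  dxy x y := B.dxy y x
  dyy x y := B.dxx y x
  hasDerivAt_toFun hu hv := by simpa [add_comm] using B.hasDerivAt_toFun hv hu
  hasDerivAt_dx hu hv := by simpa [add_comm] using B.hasDerivAt_dy hv hu
  hasDerivAt_dy hu hv := by simpa [add_comm] using B.hasDerivAt_dx hv hu
  continuous_toFun := B.continuous_toFun.comp continuous_swap
  continuous_dx := B.continuous_dy.comp continuous_swap
  continuous_dy := B.continuous_dx.comp continuous_swap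
  continuous_dxx := B.continuous_dyy.comp continuous_swap
  continuous_dxy := B.continuous_dxy.comp continuous_swap
  continuous_dyy := B.continuous_dxx.comp continuous_swap
  zero_le x y := B.zero_le y x
  coercive x y := by
    obtain ⟨τ, hτ, h⟩ := B.coercive y x
    refine ⟨τ⁻¹, inv_pos.2 hτ, fun a b => ?_⟩
    have := h b a
    rw [inv_inv, mul_comm a b]
    linarith

/-- The rescaled function `(x, y) ↦ (lμ)⁻¹ B(lx, μy)`. -/
noncomputable def rescale (B : BellmanFunction) (l μ : ℝ) (hl : 0 < l) (hμ : 0 < μ) :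
    BellmanFunction where
  toFun x y := (l * μ)⁻¹ * B.toFun (l * x) (μ * y)
  dx x y := μ⁻¹ * B.dx (l * x) (μ * y)
  dy x y := l⁻¹ * B.dy (l * x) (μ * y)
  dxx x y := l / μ * B.dxx (l * x) (μ * y)
  dxy x y := B.dxy (l * x) (μ * y)
  dyy x y := μ / l * B.dyy (l * x) (μ * y)
  hasDerivAt_toFun hu hv := by
    refine ((B.hasDerivAt_toFun (hu.const_mul l) (hv.const_mul μ)).const_mul _).congr_deriv ?_
    field_simp
  hasDerivAt_dx hu hv := by
    refine ((B.hasDerivAt_dx (hu.const_mul l) (hv.const_mul μ)).const_mul _).congr_deriv ?_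
    field_simp
  hasDerivAt_dy hu hv := by
    refine ((B.hasDerivAt_dy (hu.const_mul l) (hv.const_mul μ)).const_mul _).congr_deriv ?_
    field_simp
  continuous_toFun := continuous_const.mul
    (B.continuous_toFun.comp (by fun_prop : Continuous fun z : ℝ × ℝ => (l * z.1, μ * z.2)))
  continuous_dx := continuous_const.mul
    (B.continuous_dx.comp (by fun_prop : Continuous fun z : ℝ × ℝ => (l * z.1, μ * z.2)))
  continuous_dy := continuous_const.mul
    (B.continuous_dy.comp (by fun_prop : Continuous fun z : ℝ × ℝ => (l * z.1, μ * z.2)))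
  continuous_dxx := continuous_const.mul
    (B.continuous_dxx.comp (by fun_prop : Continuous fun z : ℝ × ℝ => (l * z.1, μ * z.2)))
  continuous_dxy :=
    B.continuous_dxy.comp (by fun_prop : Continuous fun z : ℝ × ℝ => (l * z.1, μ * z.2))
  continuous_dyy := continuous_const.mul
    (B.continuous_dyy.comp (by fun_prop : Continuous fun z : ℝ × ℝ => (l * z.1, μ * z.2)))
  zero_le x y := by
    rw [mul_zero, mul_zero]
    exact mul_le_mul_of_nonneg_left (B.zero_le _ _) (by positivity)
  coercive x y := by
    obtain ⟨τ, hτ, h⟩ := B.coercive (l * x) (μ * y)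
    refine ⟨l / μ * τ, by positivity, fun a b => ?_⟩
    have := mul_le_mul_of_nonneg_left (h (l * a) (μ * b)) (by positivity : 0 ≤ (l * μ)⁻¹)
    calc _ = (l * μ)⁻¹ * (τ * (l * a) ^ 2 + τ⁻¹ * (μ * b) ^ 2) := by field_simp
      _ ≤ _ := this
      _ = _ := by field_simp

lemma continuous_one_add_sq_rpow {X : Type*} [TopologicalSpace X] {f : X → ℝ}
    (hf : Continuous f) (a : ℝ) : Continuous fun z => (1 + f z ^ 2) ^ a :=
  (continuous_const.add (hf.pow 2)).rpow_const fun z =>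
    Or.inl (show 1 + f z ^ 2 ≠ 0 by positivity)

lemma continuous_nazarovTreil_base (m a : ℝ) :
    Continuous fun z : ℝ × ℝ => ((1 + z.1 ^ 2) ^ m + (1 + z.2 ^ 2)) ^ a :=
  ((continuous_one_add_sq_rpow continuous_fst m).add
    (continuous_const.add (continuous_snd.pow 2))).rpow_const fun z =>
      Or.inl (show (1 + z.1 ^ 2) ^ m + (1 + z.2 ^ 2) ≠ 0 by positivity)

lemma nazarovTreil_dxx_ge {m γ A W R : ℝ} (hm : 1 ≤ m) (hγ0 : 0 ≤ γ) (hγ : γ < 1 / 2)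
    (hPm1 : 0 ≤ A) (hPm0 : 0 < W) (hPR : W ≤ R) (x : ℝ) :
    2 * R ^ γ ≤ 2 * (R ^ γ + γ * m * W * R ^ (γ - 1)) +
      4 * x ^ 2 * γ * m * A *
        ((1 + m) * R ^ (γ - 1) - (1 - γ) * m * W * R ^ (γ - 2)) := by
  have hR0 : 0 < R := by linarith
  have e1 : R ^ (γ - 2) = R ^ (γ - 1) / R := by
    rw [show γ - 2 = γ - 1 - 1 by ring, Real.rpow_sub_one hR0.ne']
  have hT0 : 0 < R ^ (γ - 1) := by positivity
  have : 0 ≤ (1 + m) * R ^ (γ - 1) - (1 - γ) * m * W * R ^ (γ - 2) := by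
    have : (1 + m) * R ^ (γ - 1) - (1 - γ) * m * W * R ^ (γ - 2) =
        R ^ (γ - 1) * ((1 + m) - (1 - γ) * m * (W / R)) := by rw [e1]; field_simp
    rw [this]
    have hWR : W / R ≤ 1 := (div_le_one hR0).2 hPR
    have : (1 - γ) * m * (W / R) ≤ (1 - γ) * m * 1 := by gcongr; nlinarith
    exact mul_nonneg hT0.le (by nlinarith)
  have h1 : 0 ≤ γ * m * W * R ^ (γ - 1) := by positivity
  have h2 : 0 ≤ 4 * x ^ 2 * γ * m * A *
      ((1 + m) * R ^ (γ - 1) - (1 - γ) * m * W * R ^ (γ - 2)) :=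
    mul_nonneg (by positivity) this
  linarith

lemma nazarovTreil_dxy_le {m γ P W R x y : ℝ} (hm : 1 ≤ m) (hγ0 : 0 ≤ γ) (hγ : γ < 1 / 2)
    (hPm0 : 0 < W) (hPR : W ≤ R) (hxP : x ^ 2 ≤ P) (hyR : y ^ 2 ≤ R)
    (hPR' : P ≤ R ^ (1 - 2 * γ)) :
    |4 * x * y * γ * (R ^ (γ - 1) - (1 - γ) * m * W * R ^ (γ - 2))| ≤
      2 * (1 + m) := by
  have hR0 : 0 < R := by linarith
  have hP0 : 0 ≤ P := (sq_nonneg x).trans hxP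
  have e1 : R ^ (γ - 2) = R ^ (γ - 1) / R := by
    rw [show γ - 2 = γ - 1 - 1 by ring, Real.rpow_sub_one hR0.ne']
  have hT0 : 0 < R ^ (γ - 1) := by positivity
  have hPT : P * R ^ (γ - 1) ≤ R ^ (-γ) := by
    calc P * R ^ (γ - 1) ≤ R ^ (1 - 2 * γ) * R ^ (γ - 1) := by gcongr
      _ = R ^ (-γ) := by rw [← Real.rpow_add hR0]; ring_nf
  have hτ : 0 < R ^ γ := by positivity
  have hτ' : R ^ (-γ) = (R ^ γ)⁻¹ := Real.rpow_neg hR0.le _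
  have h1 : R ^ (γ - 1) - (1 - γ) * m * W * R ^ (γ - 2) =
      R ^ (γ - 1) * (1 - (1 - γ) * m * (W / R)) := by rw [e1]; field_simp
  have hWR : W / R ≤ 1 := (div_le_one hR0).2 hPR
  have h2 : (1 - γ) * m * (W / R) ≤ (1 - γ) * m * 1 := by gcongr; nlinarith
  have h3 : 0 ≤ (1 - γ) * m * (W / R) := mul_nonneg (by nlinarith) (by positivity)
  have h4 : |1 - (1 - γ) * m * (W / R)| ≤ 1 + m := by
    rw [abs_le]; constructor <;> linarith [mul_nonneg hγ0 (by linarith : 0 ≤ m)]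
  have h5 : |x * y| * R ^ (γ - 1) ≤ 1 := by
    have : (|x * y| * R ^ (γ - 1)) ^ 2 ≤ 1 := by
      calc (|x * y| * R ^ (γ - 1)) ^ 2 = (x ^ 2 * R ^ (γ - 1)) * (y ^ 2 * R ^ (γ - 1)) := by
            rw [mul_pow, sq_abs]; ring
        _ ≤ (P * R ^ (γ - 1)) * (R * R ^ (γ - 1)) := by gcongr
        _ ≤ R ^ (-γ) * (R * R ^ (γ - 1)) := by gcongr
        _ = 1 := by
            rw [Real.rpow_sub_one hR0.ne', mul_div_cancel₀ _ hR0.ne', hτ',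
              inv_mul_cancel₀ hτ.ne']
    exact (sq_le_one_iff₀ (by positivity)).1 this
  calc |4 * x * y * γ * (R ^ (γ - 1) - (1 - γ) * m * W * R ^ (γ - 2))|
      = 4 * γ * (|x * y| * R ^ (γ - 1)) * |1 - (1 - γ) * m * (W / R)| := by
        rw [h1, show 4 * x * y * γ * (R ^ (γ - 1) * (1 - (1 - γ) * m * (W / R))) =
          4 * γ * ((x * y) * R ^ (γ - 1)) * (1 - (1 - γ) * m * (W / R)) by ring]
        rw [abs_mul, abs_mul, abs_mul (x * y), abs_of_nonneg (by positivity : 0 ≤ 4 * γ),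
          abs_of_pos hT0]
    _ ≤ 4 * γ * 1 * (1 + m) := by gcongr
    _ ≤ 2 * (1 + m) := by
        rw [mul_one]; exact mul_le_mul_of_nonneg_right (by linarith) (by linarith)

lemma nazarovTreil_dyy_ge {γ K P Q R y : ℝ} (hγ0 : 0 ≤ γ) (hγ : γ < 1 / 2) (hK0 : 0 ≤ K)
    (hP0 : 0 < P) (hQ0 : 0 < Q) (hyQ : y ^ 2 ≤ Q) (hQR : Q ≤ R) (hPR' : P ≤ R ^ (1 - 2 * γ)) :
    (K * (1 - 2 * γ) - 1) * R ^ (-γ) ≤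
      2 * (γ * P * R ^ (γ - 1) + K * (1 - γ) * Q ^ (-γ)) -
      4 * y ^ 2 * (γ * (1 - γ) * P * R ^ (γ - 2) + K * γ * (1 - γ) * Q ^ (-γ - 1)) := by
  have hR0 : 0 < R := by linarith
  have e1 : R ^ (γ - 2) = R ^ (γ - 1) / R := by
    rw [show γ - 2 = γ - 1 - 1 by ring, Real.rpow_sub_one hR0.ne']
  have hT0 : 0 < R ^ (γ - 1) := by positivity
  have hPT : P * R ^ (γ - 1) ≤ R ^ (-γ) := by
    calc P * R ^ (γ - 1) ≤ R ^ (1 - 2 * γ) * R ^ (γ - 1) := by gcongr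
      _ = R ^ (-γ) := by rw [← Real.rpow_add hR0]; ring_nf
  have hQγ : R ^ (-γ) ≤ Q ^ (-γ) := Real.rpow_le_rpow_of_nonpos hQ0 hQR (by linarith)
  have h1 : y ^ 2 / R ≤ 1 := (div_le_one hR0).2 (by linarith)
  have h2 : y ^ 2 / Q ≤ 1 := (div_le_one hQ0).2 hyQ
  have h3 : 2 * (γ * P * R ^ (γ - 1) + K * (1 - γ) * Q ^ (-γ)) -
    4 * y ^ 2 * (γ * (1 - γ) * P * R ^ (γ - 2) + K * γ * (1 - γ) * Q ^ (-γ - 1)) =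
    2 * γ * (P * R ^ (γ - 1)) * (1 - 2 * (1 - γ) * (y ^ 2 / R)) +
    2 * (1 - γ) * (K * Q ^ (-γ) * (1 - 2 * γ * (y ^ 2 / Q))) := by
    rw [e1, Real.rpow_sub_one hQ0.ne']; field_simp; ring
  have h4 : -1 ≤ 1 - 2 * (1 - γ) * (y ^ 2 / R) := by
    have : 0 ≤ y ^ 2 / R := by positivity
    linarith [mul_nonneg hγ0 this]
  have h5 : -R ^ (-γ) ≤ 2 * γ * (P * R ^ (γ - 1)) * (1 - 2 * (1 - γ) * (y ^ 2 / R)) := by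
    have h0 : 0 ≤ P * R ^ (γ - 1) := by positivity
    calc -R ^ (-γ) ≤ -(2 * γ * (P * R ^ (γ - 1))) := by
          linarith [mul_le_of_le_one_left h0 (by linarith : 2 * γ ≤ 1)]
      _ = 2 * γ * (P * R ^ (γ - 1)) * (-1) := by ring
      _ ≤ _ := by gcongr
  have h6 : 1 - 2 * γ ≤ 1 - 2 * γ * (y ^ 2 / Q) := by
    linarith [mul_le_of_le_one_right (by linarith : 0 ≤ 2 * γ) h2]
  have h7 : K * R ^ (-γ) * (1 - 2 * γ) ≤ K * Q ^ (-γ) * (1 - 2 * γ * (y ^ 2 / Q)) := by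
    apply mul_le_mul _ h6 (by linarith) (by positivity)
    gcongr
  have h8 : 0 ≤ K * R ^ (-γ) * (1 - 2 * γ) :=
    mul_nonneg (by positivity) (by linarith)
  have h9 := mul_le_mul_of_nonneg_left h7 (by linarith : 0 ≤ 2 * (1 - γ))
  have h10 := mul_nonneg (by linarith : 0 ≤ 1 - 2 * γ) h8
  rw [h3]
  linarith

lemma nazarovTreil_coercive {m γ K : ℝ} (hm : 1 ≤ m) (hγ0 : 0 ≤ γ) (hγ : γ < 1 / 2)
    (hmγ : m * (1 - 2 * γ) = 1) (hK : 4 * (1 + m) ^ 2 + 2 ≤ K * (1 - 2 * γ)) (x y : ℝ) :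
    ∃ τ : ℝ, 0 < τ ∧ ∀ a b, τ * a ^ 2 + τ⁻¹ * b ^ 2 ≤
      (2 * (((1 + x ^ 2) ^ m + (1 + y ^ 2)) ^ γ +
          γ * m * (1 + x ^ 2) ^ m * ((1 + x ^ 2) ^ m + (1 + y ^ 2)) ^ (γ - 1)) +
        4 * x ^ 2 * γ * m * (1 + x ^ 2) ^ (m - 1) *
          ((1 + m) * ((1 + x ^ 2) ^ m + (1 + y ^ 2)) ^ (γ - 1) -
            (1 - γ) * m * (1 + x ^ 2) ^ m * ((1 + x ^ 2) ^ m + (1 + y ^ 2)) ^ (γ - 2))) * a ^ 2 +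
      2 * (4 * x * y * γ * (((1 + x ^ 2) ^ m + (1 + y ^ 2)) ^ (γ - 1) -
        (1 - γ) * m * (1 + x ^ 2) ^ m * ((1 + x ^ 2) ^ m + (1 + y ^ 2)) ^ (γ - 2))) * (a * b) +
      (2 * (γ * (1 + x ^ 2) * ((1 + x ^ 2) ^ m + (1 + y ^ 2)) ^ (γ - 1) +
          K * (1 - γ) * (1 + y ^ 2) ^ (-γ)) -
        4 * y ^ 2 * (γ * (1 - γ) * (1 + x ^ 2) * ((1 + x ^ 2) ^ m + (1 + y ^ 2)) ^ (γ - 2) +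
          K * γ * (1 - γ) * (1 + y ^ 2) ^ (-γ - 1))) * b ^ 2 := by
  have hP1 : 1 ≤ 1 + x ^ 2 := by nlinarith [sq_nonneg x]
  have hQ1 : 1 ≤ 1 + y ^ 2 := by nlinarith [sq_nonneg y]
  have hxP : x ^ 2 ≤ 1 + x ^ 2 := by linarith
  have hyR : y ^ 2 ≤ (1 + x ^ 2) ^ m + (1 + y ^ 2) := by
    have : 0 < (1 + x ^ 2) ^ m := by positivity
    linarith
  have hyQ : y ^ 2 ≤ 1 + y ^ 2 := by linarith
  generalize 1 + x ^ 2 = P at *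
  generalize 1 + y ^ 2 = Q at *
  have hP0 : 0 < P := by linarith
  have hQ0 : 0 < Q := by linarith
  have hPm0 : 0 < P ^ m := by positivity
  have hPm1 : 0 ≤ P ^ (m - 1) := by positivity
  have hPR : P ^ m ≤ P ^ m + Q := by linarith
  have hQR : Q ≤ P ^ m + Q := by linarith
  have hPR' : P ≤ (P ^ m + Q) ^ (1 - 2 * γ) := by
    calc P = (P ^ m) ^ (1 - 2 * γ) := by rw [← Real.rpow_mul hP0.le, hmγ, Real.rpow_one]
      _ ≤ _ := Real.rpow_le_rpow hPm0.le hPR (by linarith)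
  generalize P ^ m = W at *
  generalize W + Q = R at *
  have hR0 : 0 < R := by linarith
  have hK0 : 0 ≤ K := by
    by_contra! h
    nlinarith [sq_nonneg (1 + m)]
  have hτ : 0 < R ^ γ := by positivity
  have hτ' : R ^ (-γ) = (R ^ γ)⁻¹ := Real.rpow_neg hR0.le _
  have hxx := nazarovTreil_dxx_ge hm hγ0 hγ hPm1 hPm0 hPR x
  have hxy := nazarovTreil_dxy_le hm hγ0 hγ hPm0 hPR hxP hyR hPR'
  have hyy := nazarovTreil_dyy_ge hγ0 hγ hK0 hP0 hQ0 hyQ hQR hPR'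
  refine ⟨R ^ γ, hτ, fun a b => ?_⟩
  rw [← hτ']
  generalize 2 * (R ^ γ + γ * m * W * R ^ (γ - 1)) + 4 * x ^ 2 * γ * m * P ^ (m - 1) *
        ((1 + m) * R ^ (γ - 1) - (1 - γ) * m * W * R ^ (γ - 2)) = X at *
  generalize 4 * x * y * γ * (R ^ (γ - 1) - (1 - γ) * m * W * R ^ (γ - 2)) = Y at *
  generalize 2 * (γ * P * R ^ (γ - 1) + K * (1 - γ) * Q ^ (-γ)) -
      4 * y ^ 2 * (γ * (1 - γ) * P * R ^ (γ - 2) + K * γ * (1 - γ) * Q ^ (-γ - 1)) = Z at *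
  have hσ : R ^ γ * R ^ (-γ) = 1 := by rw [hτ', mul_inv_cancel₀ hτ.ne']
  have hσ0 : 0 < R ^ (-γ) := by positivity
  generalize R ^ γ = τ at *
  generalize R ^ (-γ) = σ at *
  exact quadratic_form_lower_bound hτ hσ hxx hxy (by nlinarith) a b

/-- The Nazarov–Treil type function `P R^γ + K Q^(1-γ)` with `P = 1 + x²`, `Q = 1 + y²`,
`R = P^m + Q`. -/
noncomputable def nazarovTreil (m γ K : ℝ) (hm : 1 ≤ m) (hγ0 : 0 ≤ γ) (hγ : γ < 1 / 2)
    (hmγ : m * (1 - 2 * γ) = 1) (hK : 4 * (1 + m) ^ 2 + 2 ≤ K * (1 - 2 * γ)) :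
    BellmanFunction where
  toFun x y := (1 + x ^ 2) * ((1 + x ^ 2) ^ m + (1 + y ^ 2)) ^ γ + K * (1 + y ^ 2) ^ (1 - γ)
  dx x y := 2 * x * (((1 + x ^ 2) ^ m + (1 + y ^ 2)) ^ γ +
    γ * m * (1 + x ^ 2) ^ m * ((1 + x ^ 2) ^ m + (1 + y ^ 2)) ^ (γ - 1))
  dy x y := 2 * y * (γ * (1 + x ^ 2) * ((1 + x ^ 2) ^ m + (1 + y ^ 2)) ^ (γ - 1) +
    K * (1 - γ) * (1 + y ^ 2) ^ (-γ))
  dxx x y := 2 * (((1 + x ^ 2) ^ m + (1 + y ^ 2)) ^ γ +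
      γ * m * (1 + x ^ 2) ^ m * ((1 + x ^ 2) ^ m + (1 + y ^ 2)) ^ (γ - 1)) +
    4 * x ^ 2 * γ * m * (1 + x ^ 2) ^ (m - 1) *
      ((1 + m) * ((1 + x ^ 2) ^ m + (1 + y ^ 2)) ^ (γ - 1) -
        (1 - γ) * m * (1 + x ^ 2) ^ m * ((1 + x ^ 2) ^ m + (1 + y ^ 2)) ^ (γ - 2))
  dxy x y := 4 * x * y * γ * (((1 + x ^ 2) ^ m + (1 + y ^ 2)) ^ (γ - 1) -
    (1 - γ) * m * (1 + x ^ 2) ^ m * ((1 + x ^ 2) ^ m + (1 + y ^ 2)) ^ (γ - 2))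
  dyy x y := 2 * (γ * (1 + x ^ 2) * ((1 + x ^ 2) ^ m + (1 + y ^ 2)) ^ (γ - 1) +
      K * (1 - γ) * (1 + y ^ 2) ^ (-γ)) -
    4 * y ^ 2 * (γ * (1 - γ) * (1 + x ^ 2) * ((1 + x ^ 2) ^ m + (1 + y ^ 2)) ^ (γ - 2) +
      K * γ * (1 - γ) * (1 + y ^ 2) ^ (-γ - 1))
  hasDerivAt_toFun {u v u' v' t} hu hv := by
    have hP := (hu.pow 2).const_add 1
    have hQ := (hv.pow 2).const_add 1
    have hP0 : 0 < 1 + u t ^ 2 := by positivity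
    have hQ0 : 0 < 1 + v t ^ 2 := by positivity
    have hPm := hP.rpow_const (p := m) (Or.inl hP0.ne')
    have hR := hPm.add hQ
    have hR0 : 0 < (1 + u t ^ 2) ^ m + (1 + v t ^ 2) := by positivity
    have hRγ := hR.rpow_const (p := γ) (Or.inl hR0.ne')
    have hQγ := hQ.rpow_const (p := 1 - γ) (Or.inl hQ0.ne')
    refine ((hP.mul hRγ).add (hQγ.const_mul K)).congr_deriv ?_
    simp only [Pi.add_apply, Pi.pow_apply]
    rw [show 1 - γ - 1 = -γ by ring, Real.rpow_sub_one hP0.ne' m]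
    field_simp
    ring
  hasDerivAt_dx {u v u' v' t} hu hv := by
    have hP := (hu.pow 2).const_add 1
    have hQ := (hv.pow 2).const_add 1
    have hP0 : 0 < 1 + u t ^ 2 := by positivity
    have hQ0 : 0 < 1 + v t ^ 2 := by positivity
    have hPm := hP.rpow_const (p := m) (Or.inl hP0.ne')
    have hR := hPm.add hQ
    have hR0 : 0 < (1 + u t ^ 2) ^ m + (1 + v t ^ 2) := by positivity
    have hRγ := hR.rpow_const (p := γ) (Or.inl hR0.ne')
    have hRγ1 := hR.rpow_const (p := γ - 1) (Or.inl hR0.ne')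
    refine ((hu.const_mul 2).mul (hRγ.add ((hPm.const_mul (γ * m)).mul hRγ1))).congr_deriv ?_
    simp only [Pi.add_apply, Pi.pow_apply, Pi.mul_apply]
    rw [show γ - 1 - 1 = γ - 2 by ring]
    simp only [Nat.cast_ofNat, Nat.add_one_sub_one, pow_one]
    generalize (1 + u t ^ 2) ^ m + (1 + v t ^ 2) = R
    ring
  hasDerivAt_dy {u v u' v' t} hu hv := by
    have hP := (hu.pow 2).const_add 1
    have hQ := (hv.pow 2).const_add 1
    have hP0 : 0 < 1 + u t ^ 2 := by positivity
    have hQ0 : 0 < 1 + v t ^ 2 := by positivity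
    have hPm := hP.rpow_const (p := m) (Or.inl hP0.ne')
    have hR := hPm.add hQ
    have hR0 : 0 < (1 + u t ^ 2) ^ m + (1 + v t ^ 2) := by positivity
    have hRγ1 := hR.rpow_const (p := γ - 1) (Or.inl hR0.ne')
    have hQγ := hQ.rpow_const (p := -γ) (Or.inl hQ0.ne')
    refine ((hv.const_mul 2).mul (((hP.const_mul γ).mul hRγ1).add
      (hQγ.const_mul (K * (1 - γ))))).congr_deriv ?_
    simp only [Pi.add_apply, Pi.pow_apply, Pi.mul_apply]
    rw [show γ - 1 - 1 = γ - 2 by ring]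
    simp only [Nat.cast_ofNat, Nat.add_one_sub_one, pow_one]
    have hPm1 : (1 + u t ^ 2) ^ m = (1 + u t ^ 2) * (1 + u t ^ 2) ^ (m - 1) := by
      rw [Real.rpow_sub_one hP0.ne']; field_simp
    generalize (1 + u t ^ 2) ^ m + (1 + v t ^ 2) = R
    rw [hPm1]
    ring
  continuous_toFun :=
    ((continuous_const.add (continuous_fst.pow 2)).mul (continuous_nazarovTreil_base m γ)).add
      (continuous_const.mul (continuous_one_add_sq_rpow continuous_snd (1 - γ)))
  continuous_dx :=
    (continuous_const.mul continuous_fst).mul ((continuous_nazarovTreil_base m γ).add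
      ((continuous_const.mul (continuous_one_add_sq_rpow continuous_fst m)).mul
        (continuous_nazarovTreil_base m (γ - 1))))
  continuous_dy :=
    (continuous_const.mul continuous_snd).mul
      (((continuous_const.mul (continuous_const.add (continuous_fst.pow 2))).mul
        (continuous_nazarovTreil_base m (γ - 1))).add
      (continuous_const.mul (continuous_one_add_sq_rpow continuous_snd (-γ))))
  continuous_dxx := by
    have h0 := continuous_nazarovTreil_base m γ
    have h1 := continuous_nazarovTreil_base m (γ - 1)
    have h2 := continuous_nazarovTreil_base m (γ - 2)
    have h3 := continuous_one_add_sq_rpow (continuous_fst (X := ℝ) (Y := ℝ)) m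
    have h4 := continuous_one_add_sq_rpow (continuous_fst (X := ℝ) (Y := ℝ)) (m - 1)
    exact (continuous_const.mul (h0.add ((continuous_const.mul h3).mul h1))).add
      (((((continuous_const.mul (continuous_fst.pow 2)).mul continuous_const).mul
        continuous_const).mul h4).mul
        ((continuous_const.mul h1).sub ((continuous_const.mul h3).mul h2)))
  continuous_dxy := by
    have h1 := continuous_nazarovTreil_base m (γ - 1)
    have h2 := continuous_nazarovTreil_base m (γ - 2)
    have h3 := continuous_one_add_sq_rpow (continuous_fst (X := ℝ) (Y := ℝ)) m
    exact (((continuous_const.mul continuous_fst).mul continuous_snd).mul continuous_const).mul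
      (h1.sub ((continuous_const.mul h3).mul h2))
  continuous_dyy := by
    have h1 := continuous_nazarovTreil_base m (γ - 1)
    have h2 := continuous_nazarovTreil_base m (γ - 2)
    have h3 := continuous_one_add_sq_rpow (continuous_snd (X := ℝ) (Y := ℝ)) (-γ)
    have h4 := continuous_one_add_sq_rpow (continuous_snd (X := ℝ) (Y := ℝ)) (-γ - 1)
    have h5 : Continuous fun z : ℝ × ℝ => 1 + z.1 ^ 2 := by fun_prop
    exact (continuous_const.mul (((continuous_const.mul h5).mul h1).add
      (continuous_const.mul h3))).sub ((continuous_const.mul (continuous_snd.pow 2)).mul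
        (((continuous_const.mul h5).mul h2).add (continuous_const.mul h4)))
  zero_le x y := by
    have hK0 : 0 ≤ K := by
      by_contra! h
      nlinarith [sq_nonneg (1 + m)]
    have hx : 1 + (0 : ℝ) ^ 2 ≤ 1 + x ^ 2 := by nlinarith [sq_nonneg x]
    have hy : 1 + (0 : ℝ) ^ 2 ≤ 1 + y ^ 2 := by nlinarith [sq_nonneg y]
    have hR : (1 + (0 : ℝ) ^ 2) ^ m + (1 + (0 : ℝ) ^ 2) ≤ (1 + x ^ 2) ^ m + (1 + y ^ 2) :=
      add_le_add (Real.rpow_le_rpow (by positivity) hx (by linarith)) hy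
    exact add_le_add (mul_le_mul hx (Real.rpow_le_rpow (by positivity) hR hγ0) (by positivity)
      (by positivity)) (mul_le_mul_of_nonneg_left
        (Real.rpow_le_rpow (by positivity) hy (by linarith)) hK0)
  coercive x y := nazarovTreil_coercive hm hγ0 hγ hmγ hK x y

lemma one_add_rpow_sub_one_le {s r : ℝ} (hs : 0 ≤ s) (hr : 1 ≤ r) :
    (1 + s) ^ r - 1 ≤ r * 2 ^ (r - 1) * (s + s ^ r) := by
  have h0 : (0 : ℝ) < 1 + s := by positivity
  have h1 : (1 + s) ^ r - 1 ≤ r * s * (1 + s) ^ (r - 1) := by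
    have hb : 1 + r * (-(s / (1 + s))) ≤ (1 + -(s / (1 + s))) ^ r :=
      one_add_mul_self_le_rpow_one_add (by
        rw [neg_le_neg_iff, div_le_one h0]; linarith) hr
    have e : 1 + -(s / (1 + s)) = (1 + s)⁻¹ := by field_simp; ring
    rw [e, Real.inv_rpow h0.le] at hb
    have := mul_le_mul_of_nonneg_right hb (by positivity : 0 ≤ (1 + s) ^ r)
    rw [inv_mul_cancel₀ (by positivity)] at this
    rw [Real.rpow_sub_one h0.ne']
    have e2 : (1 + r * -(s / (1 + s))) * (1 + s) ^ r =
        (1 + s) ^ r - r * s * ((1 + s) ^ r / (1 + s)) := by field_simp; ring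
    linarith
  have h2 : (1 + s) ^ (r - 1) ≤ 2 ^ (r - 1) * (1 + s ^ (r - 1)) := by
    rcases le_total s 1 with h | h
    · calc (1 + s) ^ (r - 1) ≤ 2 ^ (r - 1) :=
            Real.rpow_le_rpow h0.le (by linarith) (by linarith)
        _ ≤ _ := le_mul_of_one_le_right (by positivity)
            (by linarith [Real.rpow_nonneg hs (r - 1)])
    · calc (1 + s) ^ (r - 1) ≤ (2 * s) ^ (r - 1) :=
            Real.rpow_le_rpow h0.le (by linarith) (by linarith)
        _ = 2 ^ (r - 1) * s ^ (r - 1) := Real.mul_rpow (by norm_num) hs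
        _ ≤ _ := by gcongr; linarith
  have h3 : s * s ^ (r - 1) = s ^ r := by
    rcases hs.eq_or_lt with rfl | hs
    · rw [zero_mul, Real.zero_rpow (by linarith)]
    · rw [Real.rpow_sub_one hs.ne']; field_simp
  calc _ ≤ r * s * (1 + s) ^ (r - 1) := h1
    _ ≤ r * s * (2 ^ (r - 1) * (1 + s ^ (r - 1))) := by gcongr
    _ = r * 2 ^ (r - 1) * (s + s * s ^ (r - 1)) := by ring
    _ = _ := by rw [h3]

lemma add_rpow_le_add_of_one_le {a t γ : ℝ} (ha : 1 ≤ a) (ht : 0 ≤ t) (hγ0 : 0 ≤ γ)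
    (hγ : γ ≤ 1) : (a + t) ^ γ ≤ a ^ γ + t := by
  have h0 : 0 < a := by linarith
  have h1 : (1 + t / a) ^ γ ≤ 1 + γ * (t / a) :=
    rpow_one_add_le_one_add_mul_self
      (by linarith [div_nonneg ht h0.le]) hγ0 hγ
  have h2 : a ^ γ ≤ a := by
    simpa using Real.rpow_le_rpow_of_exponent_le ha hγ
  calc (a + t) ^ γ = a ^ γ * (1 + t / a) ^ γ := by
        rw [← Real.mul_rpow h0.le (by positivity)]; congr 1; field_simp
    _ ≤ a ^ γ * (1 + γ * (t / a)) := by gcongr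
    _ = a ^ γ + γ * (a ^ γ / a) * t := by field_simp
    _ ≤ a ^ γ + 1 * 1 * t := by
        gcongr
        exact (div_le_one h0).2 h2
    _ = _ := by ring

/-- The size bound for the Nazarov–Treil type function. -/
lemma nazarovTreil_sub_le {p q K : ℝ} (hp : 2 ≤ p) (hpq : p.HolderConjugate q) (hK : 0 ≤ K)
    (x y : ℝ) :
    (1 + x ^ 2) * ((1 + x ^ 2) ^ (p - 1) + (1 + y ^ 2)) ^ (1 - q / 2) +
        K * (1 + y ^ 2) ^ (q / 2) - (2 ^ (1 - q / 2) + K) ≤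
      (p * 2 ^ (p / 2) + 2 + K) * (x ^ 2 + |x| ^ p + |y| ^ q) := by
  have hq1 : 1 < q := hpq.symm.lt
  have hpq1 : (p - 1) * q = p := hpq.sub_one_mul_conj
  have hq2 : q ≤ 2 := by nlinarith
  have hX : |x| ^ p = (x ^ 2) ^ (p / 2) := by
    rw [← sq_abs x, ← Real.rpow_natCast, ← Real.rpow_mul (abs_nonneg x)]; congr 1; push_cast; ring
  have hY : |y| ^ q = (y ^ 2) ^ (q / 2) := by
    rw [← sq_abs y, ← Real.rpow_natCast, ← Real.rpow_mul (abs_nonneg y)]; congr 1; push_cast; ring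
  rw [hX, hY]
  have hs : 0 ≤ x ^ 2 := sq_nonneg x
  have ht : 0 ≤ y ^ 2 := sq_nonneg y
  generalize x ^ 2 = s at *
  generalize y ^ 2 = t at *
  have hγ0 : 0 ≤ 1 - q / 2 := by linarith
  have hγ1 : 1 - q / 2 ≤ 1 := by linarith
  have hsp : 0 ≤ s ^ (p / 2) := by positivity
  have htq : 0 ≤ t ^ (q / 2) := by positivity
  have hPm : 1 ≤ (1 + s) ^ (p - 1) := Real.one_le_rpow (by linarith) (by linarith)
  have h1 : (1 + s) * ((1 + s) ^ (p - 1) + 1) ^ (1 - q / 2) - 2 ^ (1 - q / 2) ≤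
      p * 2 ^ (p / 2) * (s + s ^ (p / 2)) := by
    have hb : (2 : ℝ) ^ (1 - q / 2) ≤ 2 := by
      simpa using Real.rpow_le_rpow_of_exponent_le (by norm_num : (1 : ℝ) ≤ 2) hγ1
    calc (1 + s) * ((1 + s) ^ (p - 1) + 1) ^ (1 - q / 2) - 2 ^ (1 - q / 2)
        ≤ (1 + s) * (2 * (1 + s) ^ (p - 1)) ^ (1 - q / 2) - 2 ^ (1 - q / 2) := by
          gcongr; linarith
      _ = 2 ^ (1 - q / 2) * ((1 + s) ^ (p / 2) - 1) := by
          rw [Real.mul_rpow (by norm_num) (by positivity), ← Real.rpow_mul (by positivity),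
            show (p - 1) * (1 - q / 2) = p / 2 - 1 by linarith,
            Real.rpow_sub_one (by positivity)]
          field_simp
      _ ≤ 2 * (p / 2 * 2 ^ (p / 2 - 1) * (s + s ^ (p / 2))) := by
          have := one_add_rpow_sub_one_le hs (by linarith : 1 ≤ p / 2)
          have h0 : 0 ≤ (1 + s) ^ (p / 2) - 1 :=
            sub_nonneg.2 (Real.one_le_rpow (by linarith) (by linarith))
          gcongr
      _ = p * 2 ^ (p / 2 - 1) * (s + s ^ (p / 2)) := by ring
      _ ≤ _ := by
          gcongr
          · norm_num
          · linarith
  obtain ⟨N, hN, hN1, hN2⟩ : ∃ N, ((1 + s) ^ (p - 1) + (1 + t)) ^ (1 - q / 2) ≤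
      ((1 + s) ^ (p - 1) + 1) ^ (1 - q / 2) + N ∧ N ≤ t ^ (q / 2) ∧ N ≤ t ^ (1 - q / 2) := by
    rw [← add_assoc]
    rcases le_total t 1 with h | h
    · refine ⟨t, add_rpow_le_add_of_one_le (by linarith) ht hγ0 hγ1, ?_, ?_⟩
      · exact Real.self_le_rpow_of_le_one ht h (by linarith)
      · exact Real.self_le_rpow_of_le_one ht h (by linarith)
    · refine ⟨t ^ (1 - q / 2), Real.rpow_add_le_add_rpow (by linarith) ht hγ0 hγ1,
        Real.rpow_le_rpow_of_exponent_le h (by linarith), le_rfl⟩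
  have h2 : s * t ^ (1 - q / 2) ≤ s ^ (p / 2) + t ^ (q / 2) := by
    have hp0 : 0 < p := by linarith
    have hq0 : 0 < q := by linarith
    have hw : 1 - 2 / p = 2 / q - 1 := by
      have := hpq.inv_add_inv_eq_one
      rw [div_eq_mul_inv, div_eq_mul_inv]; linarith
    have := Real.geom_mean_le_arith_mean2_weighted (w₁ := 2 / p) (w₂ := 1 - 2 / p)
      (by positivity) (sub_nonneg.2 ((div_le_one hp0).2 hp)) hsp htq (by ring)
    rw [← Real.rpow_mul hs, ← Real.rpow_mul ht, show p / 2 * (2 / p) = 1 by field_simp,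
      Real.rpow_one, hw, show q / 2 * (2 / q - 1) = 1 - q / 2 by field_simp] at this
    refine this.trans (add_le_add ?_ ?_)
    · exact mul_le_of_le_one_left hsp ((div_le_one hp0).2 hp)
    · refine mul_le_of_le_one_left htq ?_
      rw [← hw]; linarith [div_nonneg zero_le_two hp0.le]
  have h3 : (1 + t) ^ (q / 2) ≤ 1 + t ^ (q / 2) := by
    simpa using Real.rpow_add_le_add_rpow zero_le_one ht (by linarith : 0 ≤ q / 2) (by linarith)
  have h4 := mul_le_mul_of_nonneg_left h3 hK
  have h5 := mul_le_mul_of_nonneg_left hN (by linarith : 0 ≤ 1 + s)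
  have h6 := mul_le_mul_of_nonneg_left hN2 hs
  have h7 : 0 ≤ p * 2 ^ (p / 2) * t ^ (q / 2) := by positivity
  have h8 : 0 ≤ K * (s + s ^ (p / 2)) := by positivity
  linarith

/-- For conjugate exponents there are Bellman functions of size `|x|^p + |y|^q`, up to an
arbitrarily small quadratic error. -/
theorem exists_of_two_le {p q : ℝ} (hp : 2 ≤ p) (hpq : p.HolderConjugate q) :
    ∃ C : ℝ, 0 < C ∧ ∀ δ : ℝ, 0 < δ → ∃ B : BellmanFunction, ∀ x y,
      B.toFun x y - B.toFun 0 0 ≤ C * (|x| ^ p + |y| ^ q) + δ * x ^ 2 := by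
  have hq1 : 1 < q := hpq.symm.lt
  have hpq1 : (p - 1) * q = p := hpq.sub_one_mul_conj
  have hq2 : q ≤ 2 := by nlinarith
  have hq0 : 0 < q - 1 := by linarith
  set K : ℝ := (4 * p ^ 2 + 2) / (q - 1) with hK
  have hK0 : 0 ≤ K := by positivity
  let B₀ := nazarovTreil (p - 1) (1 - q / 2) K (by linarith) (by linarith) (by linarith)
    (by linear_combination hpq1) (by
      rw [hK, show 1 - 2 * (1 - q / 2) = q - 1 by ring, div_mul_cancel₀ _ hq0.ne']
      ring_nf; rfl)
  set C : ℝ := p * 2 ^ (p / 2) + 2 + K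
  have hC : 0 < C := by positivity
  have hB₀ : ∀ x y, B₀.toFun x y - B₀.toFun 0 0 ≤ C * (x ^ 2 + |x| ^ p + |y| ^ q) := by
    intro x y
    have := nazarovTreil_sub_le hp hpq hK0 x y
    have e : B₀.toFun 0 0 = 2 ^ (1 - q / 2) + K := by
      simp [B₀, nazarovTreil, one_add_one_eq_two]
    rw [e]
    simpa [B₀, nazarovTreil] using this
  refine ⟨2 * C, by positivity, fun δ hδ => ?_⟩
  rcases hp.eq_or_lt with rfl | hp2
  · refine ⟨B₀, fun x y => (hB₀ x y).trans ?_⟩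
    have : |x| ^ (2 : ℝ) = x ^ 2 := by norm_num
    rw [this]
    have h1 : 0 ≤ C * |y| ^ q := by positivity
    have h2 : 0 ≤ δ * x ^ 2 := by positivity
    linarith
  · set l : ℝ := (C / δ) ^ (p - 2)⁻¹
    have hl : 0 < l := by positivity
    have hlp : C * (l ^ (2 - p)) = δ := by
      rw [← Real.rpow_mul (by positivity), show (p - 2)⁻¹ * (2 - p) = -1 by
        have : p - 2 ≠ 0 := by linarith
        field_simp; ring, Real.rpow_neg_one]
      field_simp
    refine ⟨B₀.rescale l (l ^ (p - 1)) hl (by positivity), fun x y => ?_⟩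
    have e1 : l * l ^ (p - 1) = l ^ p := by
      rw [Real.rpow_sub_one hl.ne']; field_simp
    have e2 : (l ^ (p - 1)) ^ q = l ^ p := by rw [← Real.rpow_mul hl.le, hpq1]
    have e3 : l ^ (2 - p) = (l ^ p)⁻¹ * l ^ 2 := by
      rw [Real.rpow_sub hl, Real.rpow_two]; field_simp
    have hlp0 : 0 < l ^ p := by positivity
    calc _ = (l ^ p)⁻¹ * (B₀.toFun (l * x) (l ^ (p - 1) * y) - B₀.toFun 0 0) := by
          simp only [rescale, mul_zero, e1]; ring
      _ ≤ (l ^ p)⁻¹ * (C * ((l * x) ^ 2 + |l * x| ^ p + |l ^ (p - 1) * y| ^ q)) := by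
          gcongr; exact hB₀ _ _
      _ = C * ((l ^ p)⁻¹ * l ^ 2) * x ^ 2 + C * (|x| ^ p + |y| ^ q) := by
          rw [abs_mul, abs_mul, Real.mul_rpow (abs_nonneg _) (abs_nonneg _),
            Real.mul_rpow (abs_nonneg _) (abs_nonneg _), abs_of_pos hl,
            abs_of_pos (by positivity : 0 < l ^ (p - 1)), e2]
          field_simp
          ring
      _ ≤ _ := by
          rw [← e3, hlp]
          have : 0 ≤ C * (|x| ^ p + |y| ^ q) := by positivity
          linarith

theorem exists_of_holderConjugate {p q : ℝ} (hpq : p.HolderConjugate q) :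
    ∃ C : ℝ, 0 < C ∧ ∀ δ : ℝ, 0 < δ → ∃ B : BellmanFunction, ∀ x y,
      B.toFun x y - B.toFun 0 0 ≤ C * (|x| ^ p + |y| ^ q) + δ * (x ^ 2 + y ^ 2) := by
  rcases le_total 2 p with hp | hp
  · obtain ⟨C, hC, h⟩ := exists_of_two_le hp hpq
    refine ⟨C, hC, fun δ hδ => ?_⟩
    obtain ⟨B, hB⟩ := h δ hδ
    exact ⟨B, fun x y => (hB x y).trans (by nlinarith [sq_nonneg y])⟩
  · have hq : 2 ≤ q := by
      have := hpq.sub_one_mul_conj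
      have := hpq.sub_one_pos
      have := hpq.symm.pos
      nlinarith
    obtain ⟨C, hC, h⟩ := exists_of_two_le hq hpq.symm
    refine ⟨C, hC, fun δ hδ => ?_⟩
    obtain ⟨B, hB⟩ := h δ hδ
    exact ⟨B.swap, fun x y => (hB y x).trans (by nlinarith [sq_nonneg x])⟩

end BellmanFunction

section HeatExtension

open SchwartzMap LineDeriv Laplacian

lemma one_add_pow_mul_exp_neg_sq_le (M : ℕ) {r : ℝ} (hr : 0 ≤ r) :
    (1 + r) ^ M * Real.exp (-r ^ 2 / 2) ≤ M.factorial * Real.exp (3 / 2) := by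
  have h1 : (1 + r) ^ M ≤ M.factorial * Real.exp (1 + r) := by
    have := Real.pow_div_factorial_le_exp (1 + r) (by linarith) M
    rwa [div_le_iff₀' (by positivity)] at this
  calc _ ≤ M.factorial * Real.exp (1 + r) * Real.exp (-r ^ 2 / 2) := by gcongr
    _ = M.factorial * Real.exp (1 + r + -r ^ 2 / 2) := by rw [mul_assoc, Real.exp_add (1 + r)]
    _ ≤ _ := by
      gcongr
      nlinarith [sq_nonneg (r - 1)]

variable {E : Type*} [NormedAddCommGroup E] [InnerProductSpace ℝ E]

lemma exists_one_add_norm_pow_mul_le (f : 𝓢(E, ℝ)) (K : ℕ) :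
    ∃ D : ℝ, 0 ≤ D ∧ ∀ x, (1 + ‖x‖) ^ K * |f x| ≤ D := by
  refine ⟨2 ^ K * (Finset.Iic (K, 0)).sup (fun m => SchwartzMap.seminorm ℝ m.1 m.2) f,
    by positivity, fun x => ?_⟩
  simpa using one_add_le_sup_seminorm_apply (𝕜 := ℝ) (m := (K, 0)) le_rfl le_rfl f x

lemma exists_abs_le (f : 𝓢(E, ℝ)) : ∃ D : ℝ, 0 ≤ D ∧ ∀ x, |f x| ≤ D := by
  simpa using exists_one_add_norm_pow_mul_le f 0

variable [FiniteDimensional ℝ E] [MeasurableSpace E] [BorelSpace E]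

lemma integrable_one_add_norm_pow_mul_exp (N : ℕ) :
    Integrable fun z : E => (1 + ‖z‖) ^ N * Real.exp (-‖z‖ ^ 2 / 2) := by
  set d := Module.finrank ℝ E + 1
  have h := (integrable_one_add_norm (E := E) (μ := volume) (r := d)
    (by simp [d])).const_mul ((N + d).factorial * Real.exp (3 / 2))
  refine h.mono' (by fun_prop) (.of_forall fun z => ?_)
  rw [Real.norm_of_nonneg (by positivity), Real.rpow_neg (by positivity), Real.rpow_natCast,
    ← div_eq_mul_inv, le_div_iff₀ (by positivity)]
  calc _ = (1 + ‖z‖) ^ (N + d) * Real.exp (-‖z‖ ^ 2 / 2) := by ring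
    _ ≤ _ := one_add_pow_mul_exp_neg_sq_le _ (norm_nonneg z)

/-- The standard Gaussian density. -/
noncomputable def heatKernel (z : E) : ℝ :=
  (∫ y : E, Real.exp (-‖y‖ ^ 2 / 2))⁻¹ * Real.exp (-‖z‖ ^ 2 / 2)

lemma heatKernel_nonneg (z : E) : 0 ≤ heatKernel z :=
  mul_nonneg (inv_nonneg.2 (integral_nonneg fun _ => (Real.exp_pos _).le)) (Real.exp_pos _).le

lemma continuous_heatKernel : Continuous (heatKernel : E → ℝ) := by
  unfold heatKernel
  fun_prop

lemma integrable_one_add_norm_pow_mul_heatKernel (N : ℕ) :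
    Integrable fun z : E => (1 + ‖z‖) ^ N * heatKernel z := by
  refine ((integrable_one_add_norm_pow_mul_exp N).const_mul
    (∫ y : E, Real.exp (-‖y‖ ^ 2 / 2))⁻¹).congr (.of_forall fun z => ?_)
  simp only [heatKernel]
  ring

lemma integrable_heatKernel : Integrable (heatKernel : E → ℝ) := by
  simpa using integrable_one_add_norm_pow_mul_heatKernel (E := E) 0

lemma integral_heatKernel : ∫ z : E, heatKernel z = 1 := by
  have h : Integrable fun z : E => Real.exp (-‖z‖ ^ 2 / 2) := by
    simpa using integrable_one_add_norm_pow_mul_exp (E := E) 0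
  have := integral_exp_pos h
  simp only [heatKernel]
  rw [integral_const_mul, inv_mul_cancel₀ this.ne']

lemma heatKernel_le : ∃ c : ℝ, 0 ≤ c ∧ ∀ z : E, heatKernel z ≤ c := by
  refine ⟨(∫ y : E, Real.exp (-‖y‖ ^ 2 / 2))⁻¹,
    inv_nonneg.2 (integral_nonneg fun _ => (Real.exp_pos _).le), fun z => ?_⟩
  refine mul_le_of_le_one_right (inv_nonneg.2 (integral_nonneg fun _ => (Real.exp_pos _).le)) ?_
  rw [Real.exp_le_one_iff]
  have := sq_nonneg ‖z‖
  linarith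

lemma hasFDerivAt_heatKernel (z : E) :
    HasFDerivAt heatKernel (-heatKernel z • innerSL ℝ z) z := by
  have h := (((hasStrictFDerivAt_norm_sq z).hasFDerivAt.neg.mul_const (2⁻¹ : ℝ)).exp).const_mul
    (∫ y : E, Real.exp (-‖y‖ ^ 2 / 2))⁻¹
  refine (h.congr_fderiv ?_).congr_of_eventuallyEq (.of_forall fun y => ?_)
  · ext v
    simp [heatKernel, div_eq_mul_inv]
    ring
  · simp [heatKernel, div_eq_mul_inv]

/-- The Gaussian average of `f` at scale `s`; up to the time change `t = s² / 2` this is the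
heat flow. -/
noncomputable def heatExt (f : 𝓢(E, ℝ)) (s : ℝ) (x : E) : ℝ :=
  ∫ z, heatKernel z * f (x + s • z)

lemma integrable_one_add_norm_pow_mul_heatKernel_mul (f : 𝓢(E, ℝ)) (s : ℝ) (x : E) (N : ℕ) :
    Integrable fun z => (1 + ‖z‖) ^ N * heatKernel z * f (x + s • z) := by
  obtain ⟨D, hD, h⟩ := exists_abs_le f
  refine ((integrable_one_add_norm_pow_mul_heatKernel N).mul_const D).mono' ?_
    (.of_forall fun z => ?_)
  · have := continuous_heatKernel (E := E)
    exact Continuous.aestronglyMeasurable (by fun_prop)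
  · have := heatKernel_nonneg z
    rw [norm_mul, Real.norm_of_nonneg (by positivity)]
    gcongr
    exact h _

lemma integrable_heatKernel_mul (f : 𝓢(E, ℝ)) (s : ℝ) (x : E) :
    Integrable fun z => heatKernel z * f (x + s • z) := by
  simpa using integrable_one_add_norm_pow_mul_heatKernel_mul f s x 0

lemma heatExt_zero (f : 𝓢(E, ℝ)) (x : E) : heatExt f 0 x = f x := by
  simp [heatExt, integral_mul_const, integral_heatKernel]

lemma heatExt_sum {ι : Type*} (t : Finset ι) (f : ι → 𝓢(E, ℝ)) (s : ℝ) (x : E) :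
    heatExt (∑ i ∈ t, f i) s x = ∑ i ∈ t, heatExt (f i) s x := by
  simp only [heatExt, sum_apply, Finset.mul_sum]
  exact integral_finsetSum _ fun i _ => integrable_heatKernel_mul (f i) s x

lemma exists_one_add_norm_pow_mul_heatExt_le (f : 𝓢(E, ℝ)) (K : ℕ) :
    ∃ C : ℝ, 0 ≤ C ∧ ∀ s x, (1 + ‖x‖) ^ K * |heatExt f s x| ≤ C * (1 + |s|) ^ K := by
  obtain ⟨D, hD, h⟩ := exists_one_add_norm_pow_mul_le f K
  refine ⟨D * ∫ z : E, (1 + ‖z‖) ^ K * heatKernel z, mul_nonneg hD (integral_nonneg fun z =>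
    mul_nonneg (by positivity) (heatKernel_nonneg z)), fun s x => ?_⟩
  have h0 : |heatExt f s x| ≤ ∫ z, heatKernel z * |f (x + s • z)| := by
    refine (abs_integral_le_integral_abs).trans_eq (integral_congr_ae (.of_forall fun z => ?_))
    simp [abs_mul, abs_of_nonneg (heatKernel_nonneg z)]
  calc (1 + ‖x‖) ^ K * |heatExt f s x|
      ≤ (1 + ‖x‖) ^ K * ∫ z, heatKernel z * |f (x + s • z)| := by gcongr
    _ = ∫ z, (1 + ‖x‖) ^ K * (heatKernel z * |f (x + s • z)|) := (integral_const_mul _ _).symm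
    _ ≤ ∫ z, D * (1 + |s|) ^ K * ((1 + ‖z‖) ^ K * heatKernel z) := by
        refine integral_mono_of_nonneg (.of_forall fun z => ?_)
          ((integrable_one_add_norm_pow_mul_heatKernel K).const_mul _) (.of_forall fun z => ?_)
        · have := heatKernel_nonneg z
          positivity
        · have hρ := heatKernel_nonneg z
          have hx : 1 + ‖x‖ ≤ (1 + ‖x + s • z‖) * ((1 + |s|) * (1 + ‖z‖)) := by
            have : ‖x‖ ≤ ‖x + s • z‖ + |s| * ‖z‖ := by
              simpa [norm_smul] using norm_sub_le (x + s • z) (s • z)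
            have h1 := norm_nonneg (x + s • z)
            have h2 := norm_nonneg z
            have h3 := abs_nonneg s
            nlinarith [mul_nonneg h1 h2, mul_nonneg h1 h3, mul_nonneg (mul_nonneg h1 h2) h3,
              mul_nonneg h2 h3]
          calc (1 + ‖x‖) ^ K * (heatKernel z * |f (x + s • z)|)
            _ ≤ ((1 + ‖x + s • z‖) * ((1 + |s|) * (1 + ‖z‖))) ^ K *
                (heatKernel z * |f (x + s • z)|) := by gcongr
            _ = ((1 + ‖x + s • z‖) ^ K * |f (x + s • z)|) *
                ((1 + |s|) ^ K * ((1 + ‖z‖) ^ K * heatKernel z)) := by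
                  rw [mul_pow, mul_pow]; ring
            _ ≤ D * ((1 + |s|) ^ K * ((1 + ‖z‖) ^ K * heatKernel z)) := by
                  refine mul_le_mul_of_nonneg_right (h _) (by positivity)
            _ = _ := by ring
    _ = _ := by rw [integral_const_mul]; ring

lemma continuous_heatExt (f : 𝓢(E, ℝ)) (s : ℝ) : Continuous (heatExt f s) := by
  obtain ⟨D, hD, h⟩ := exists_abs_le f
  have := continuous_heatKernel (E := E)
  refine continuous_of_dominated (bound := fun z => heatKernel z * D)
    (fun x => Continuous.aestronglyMeasurable (by fun_prop))
    (fun x => .of_forall fun z => ?_) (integrable_heatKernel.mul_const D)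
    (.of_forall fun z => by fun_prop)
  rw [norm_mul, Real.norm_of_nonneg (heatKernel_nonneg z)]
  exact mul_le_mul_of_nonneg_left (h _) (heatKernel_nonneg z)

lemma integrable_heatExt (f : 𝓢(E, ℝ)) (s : ℝ) : Integrable (heatExt f s) := by
  set d := Module.finrank ℝ E + 1
  obtain ⟨C, hC, h⟩ := exists_one_add_norm_pow_mul_heatExt_le f d
  refine ((integrable_one_add_norm (E := E) (μ := volume) (r := d)
    (by simp [d])).const_mul (C * (1 + |s|) ^ d)).mono'
    (continuous_heatExt f s).aestronglyMeasurable (.of_forall fun x => ?_)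
  rw [Real.rpow_neg (by positivity), Real.rpow_natCast, ← div_eq_mul_inv,
    le_div_iff₀ (by positivity), mul_comm]
  exact h s x

lemma hasDerivAt_integral_heatKernel_mul (f : 𝓢(E, ℝ)) (x e : E) (s σ t : ℝ) :
    HasDerivAt (fun t : ℝ => ∫ z, heatKernel z * f (x + t • e + (s + t * σ) • z))
      (∫ z, heatKernel z * fderiv ℝ f (x + t • e + (s + t * σ) • z) (e + σ • z)) t := by
  have hc := continuous_heatKernel (E := E)
  have hf' : Continuous (fderiv ℝ f) := (f.smooth 1).continuous_fderiv one_ne_zero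
  obtain ⟨D, hD⟩ : ∃ D : ℝ, ∀ x, ‖fderiv ℝ f x‖ ≤ D := by
    obtain ⟨D, hD⟩ := f.decay' 0 1
    refine ⟨D, fun x => ?_⟩
    have := hD x
    rw [pow_zero, one_mul, norm_iteratedFDeriv_one] at this
    exact this
  refine (hasDerivAt_integral_of_dominated_loc_of_deriv_le (s := Set.univ)
    (F' := fun t z => heatKernel z * fderiv ℝ f (x + t • e + (s + t * σ) • z) (e + σ • z))
    (bound := fun z => D * (‖e‖ + |σ|) * ((1 + ‖z‖) ^ 1 * heatKernel z)) Filter.univ_mem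
    (.of_forall fun t => Continuous.aestronglyMeasurable (by fun_prop)) ?_
    (Continuous.aestronglyMeasurable (by fun_prop)) (.of_forall fun z t _ => ?_)
    ((integrable_one_add_norm_pow_mul_heatKernel 1).const_mul _)
    (.of_forall fun z t _ => ?_)).2
  · exact integrable_heatKernel_mul f (s + t * σ) (x + t • e)
  · have hρ := heatKernel_nonneg z
    have hD0 : 0 ≤ D := (norm_nonneg _).trans (hD 0)
    rw [norm_mul, Real.norm_of_nonneg hρ]
    have h1 : ‖e + σ • z‖ ≤ (‖e‖ + |σ|) * (1 + ‖z‖) := by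
      refine (norm_add_le _ _).trans ?_
      rw [norm_smul, Real.norm_eq_abs]
      nlinarith [norm_nonneg e, norm_nonneg z, abs_nonneg σ,
        mul_nonneg (norm_nonneg e) (norm_nonneg z)]
    calc _ ≤ heatKernel z * (D * ((‖e‖ + |σ|) * (1 + ‖z‖))) := by
          gcongr
          exact (ContinuousLinearMap.le_opNorm _ _).trans (by gcongr; exact hD _)
      _ = _ := by ring
  · refine HasDerivAt.const_mul _ ?_
    have hin : HasDerivAt (fun t : ℝ => x + t • e + (s + t * σ) • z) (e + σ • z) t := by
      have h1 : HasDerivAt (fun t : ℝ => x + t • e) e t := by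
        simpa using ((hasDerivAt_id t).smul_const e).const_add x
      have h2 : HasDerivAt (fun t : ℝ => (s + t * σ) • z) (σ • z) t := by
        simpa using (((hasDerivAt_id t).mul_const σ).const_add s).smul_const z
      exact h1.add h2
    exact (f.differentiableAt (x := x + t • e + (s + t * σ) • z)).hasFDerivAt.comp_hasDerivAt t hin

lemma hasDerivAt_heatExt_line (f : 𝓢(E, ℝ)) (s : ℝ) (x e : E) (t : ℝ) :
    HasDerivAt (fun t : ℝ => heatExt f s (x + t • e)) (heatExt (∂_{e} f) s (x + t • e)) t := by
  simpa [heatExt, lineDerivOp_apply_eq_fderiv] using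
    hasDerivAt_integral_heatKernel_mul f x e s 0 t

lemma integral_heatKernel_mul_inner_mul (f : 𝓢(E, ℝ)) (x e : E) (s : ℝ) :
    ∫ z, heatKernel z * inner ℝ z e * f (x + s • z) = s * heatExt (∂_{e} f) s x := by
  have hf : ∀ z, HasFDerivAt (fun z => f (x + s • z)) (s • fderiv ℝ f (x + s • z)) z := fun z => by
    have h1 : HasFDerivAt (fun z : E => x + s • z) (s • ContinuousLinearMap.id ℝ E) z :=
      ((hasFDerivAt_id z).const_smul s).const_add x
    refine ((f.differentiableAt (x := x + s • z)).hasFDerivAt.comp z h1).congr_fderiv ?_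
    ext v
    simp
  have h1 := integral_mul_fderiv_eq_neg_fderiv_mul_of_integrable (μ := (volume : Measure E))
    (f := heatKernel) (g := fun z => f (x + s • z)) (v := e) ?_ ?_ ?_
    (fun z _ => (hasFDerivAt_heatKernel z).differentiableAt) (fun z _ => (hf z).differentiableAt)
  · simp only [(hasFDerivAt_heatKernel _).fderiv, (hf _).fderiv] at h1
    simp only [_root_.smul_apply, innerSL_apply_apply, smul_eq_mul, neg_mul,
      integral_neg, neg_neg] at h1
    rw [← h1, heatExt, ← integral_const_mul]
    refine integral_congr_ae (.of_forall fun z => ?_)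
    simp only [lineDerivOp_apply_eq_fderiv]
    ring
  · simp only [(hasFDerivAt_heatKernel _).fderiv]
    have hc := continuous_heatKernel (E := E)
    refine ((integrable_one_add_norm_pow_mul_heatKernel_mul f s x 1).mul_const ‖e‖).mono
      (Continuous.aestronglyMeasurable ?_) (.of_forall fun z => ?_)
    · simp only [_root_.smul_apply, innerSL_apply_apply, smul_eq_mul]
      fun_prop
    · simp only [_root_.smul_apply, innerSL_apply_apply, smul_eq_mul, norm_mul,
        norm_neg, norm_norm, norm_pow]
      have : ‖inner ℝ z e‖ ≤ ‖1 + ‖z‖‖ ^ 1 * ‖e‖ := by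
        refine (norm_inner_le_norm z e).trans ?_
        rw [pow_one, Real.norm_of_nonneg (by positivity)]
        gcongr
        linarith
      calc _ ≤ ‖heatKernel z‖ * (‖1 + ‖z‖‖ ^ 1 * ‖e‖) * ‖f (x + s • z)‖ := by gcongr
        _ = _ := by ring
  · simp only [(hf _).fderiv]
    refine ((integrable_heatKernel_mul (∂_{e} f) s x).const_mul s).congr (.of_forall fun z => ?_)
    simp only [lineDerivOp_apply_eq_fderiv, _root_.smul_apply, smul_eq_mul]
    ring
  · exact integrable_heatKernel_mul f s x

lemma hasDerivAt_heatExt (f : 𝓢(E, ℝ)) (x : E) (s : ℝ) :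
    HasDerivAt (fun s => heatExt f s x) (s * heatExt (Δ f) s x) s := by
  have h := hasDerivAt_integral_heatKernel_mul f x 0 0 1 s
  simp only [smul_zero, add_zero, zero_add, mul_one, one_smul] at h
  refine h.congr_deriv ?_
  symm
  have b := stdOrthonormalBasis ℝ E
  rw [laplacian_eq_sum b, heatExt_sum, Finset.mul_sum]
  simp only [← integral_heatKernel_mul_inner_mul]
  rw [← integral_finsetSum]
  · refine integral_congr_ae (.of_forall fun z => ?_)
    simp only
    conv_rhs => rw [← b.sum_repr' z]
    rw [map_sum, Finset.mul_sum, b.sum_repr' z]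
    refine Finset.sum_congr rfl fun i _ => ?_
    rw [map_smul, lineDerivOp_apply_eq_fderiv, real_inner_comm, smul_eq_mul]
    ring
  · intro i _
    have hc := continuous_heatKernel (E := E)
    refine (integrable_one_add_norm_pow_mul_heatKernel_mul (∂_{b i} f) s x 1).mono
      (Continuous.aestronglyMeasurable (by fun_prop)) (.of_forall fun z => ?_)
    simp only [norm_mul, norm_pow]
    have : ‖inner ℝ z (b i)‖ ≤ ‖1 + ‖z‖‖ ^ 1 := by
      refine (norm_inner_le_norm z (b i)).trans ?_
      rw [b.norm_eq_one, pow_one, Real.norm_of_nonneg (by positivity)]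
      linarith
    calc _ ≤ ‖heatKernel z‖ * (‖1 + ‖z‖‖ ^ 1) * ‖(∂_{b i} f) (x + s • z)‖ := by gcongr
      _ = _ := by ring

lemma exists_abs_heatExt_le (f : 𝓢(E, ℝ)) :
    ∃ C : ℝ, ∀ s : ℝ, 0 < s → ∀ x, |heatExt f s x| ≤ C * (s ^ Module.finrank ℝ E)⁻¹ := by
  obtain ⟨c, hc, h⟩ := heatKernel_le (E := E)
  refine ⟨c * ∫ y, |f y|, fun s hs x => ?_⟩
  have hint : Integrable fun z => |f (x + s • z)| :=
    ((f.integrable.comp_add_left x).comp_smul hs.ne').abs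
  calc |heatExt f s x| ≤ ∫ z, |heatKernel z * f (x + s • z)| := abs_integral_le_integral_abs
    _ ≤ ∫ z, c * |f (x + s • z)| := by
        refine integral_mono (integrable_heatKernel_mul f s x).abs (hint.const_mul c) fun z => ?_
        simp only [abs_mul, abs_of_nonneg (heatKernel_nonneg z)]
        gcongr
        exact h z
    _ = _ := by
        rw [integral_const_mul, Measure.integral_comp_smul volume (fun y => |f (x + y)|) s,
          integral_add_left_eq_self (fun y => |f y|) x, abs_of_pos (by positivity), smul_eq_mul]
        ring

lemma integral_abs_heatExt_le (f : 𝓢(E, ℝ)) (s : ℝ) :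
    ∫ x, |heatExt f s x| ≤ ∫ x, |f x| := by
  have hc := continuous_heatKernel (E := E)
  have key : ∫⁻ x, ‖heatExt f s x‖ₑ ≤ ∫⁻ x, ‖f x‖ₑ := by
    calc ∫⁻ x, ‖heatExt f s x‖ₑ ≤ ∫⁻ x, ∫⁻ z, ‖heatKernel z‖ₑ * ‖f (x + s • z)‖ₑ := by
          refine lintegral_mono fun x => (enorm_integral_le_lintegral_enorm _).trans_eq ?_
          simp only [enorm_mul]
      _ = ∫⁻ z, ∫⁻ x, ‖heatKernel z‖ₑ * ‖f (x + s • z)‖ₑ := by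
          refine lintegral_lintegral_swap (Continuous.measurable ?_).aemeasurable
          have h1 : Continuous fun p : E × E => heatKernel p.2 * f (p.1 + s • p.2) := by fun_prop
          simpa only [Function.uncurry_def, ← enorm_mul] using h1.enorm
      _ = ∫⁻ z : E, ‖heatKernel z‖ₑ * ∫⁻ x, ‖f x‖ₑ := by
          refine lintegral_congr fun z => ?_
          rw [lintegral_const_mul _ (by
              have : Continuous fun x => f (x + s • z) := by fun_prop
              exact this.enorm.measurable),
            lintegral_add_right_eq_self (fun x => ‖f x‖ₑ) (s • z)]
      _ = _ := by
          rw [lintegral_mul_const _ hc.enorm.measurable]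
          have : ∫⁻ z : E, ‖heatKernel z‖ₑ = 1 := by
            rw [← ofReal_integral_norm_eq_lintegral_enorm integrable_heatKernel]
            simp [abs_of_nonneg (heatKernel_nonneg _), integral_heatKernel]
          rw [this, one_mul]
  rw [← ofReal_integral_norm_eq_lintegral_enorm (integrable_heatExt f s),
    ← ofReal_integral_norm_eq_lintegral_enorm f.integrable] at key
  exact (ENNReal.ofReal_le_ofReal_iff (integral_nonneg fun _ => norm_nonneg _)).1 key

end HeatExtension

section HeatFlowMonotonicity

open SchwartzMap LineDeriv Laplacian

lemma exists_abs_le_of_continuous {G : ℝ → ℝ → ℝ} (hG : Continuous fun z : ℝ × ℝ => G z.1 z.2)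
    (R : ℝ) : ∃ M : ℝ, 0 ≤ M ∧ ∀ x y, |x| ≤ R → |y| ≤ R → |G x y| ≤ M := by
  obtain ⟨M, hM⟩ := ((isCompact_Icc (a := -R) (b := R)).prod
    (isCompact_Icc (a := -R) (b := R))).exists_bound_of_continuousOn hG.continuousOn
  exact ⟨max M 0, le_max_right _ _, fun x y hx hy =>
    (hM (x, y) ⟨abs_le.1 hx, abs_le.1 hy⟩).trans (le_max_left _ _)⟩

/-- A function of two variables is Lipschitz at the origin, on bounded sets, if it has continuous
partial derivatives. -/
lemma exists_abs_sub_le_of_hasDerivAt {G Gx Gy : ℝ → ℝ → ℝ}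
    (hG : ∀ {u v : ℝ → ℝ} {u' v' t : ℝ}, HasDerivAt u u' t → HasDerivAt v v' t →
      HasDerivAt (fun s => G (u s) (v s)) (Gx (u t) (v t) * u' + Gy (u t) (v t) * v') t)
    (hGx : Continuous fun z : ℝ × ℝ => Gx z.1 z.2) (hGy : Continuous fun z : ℝ × ℝ => Gy z.1 z.2)
    (R : ℝ) : ∃ M : ℝ, 0 ≤ M ∧ ∀ x y, |x| ≤ R → |y| ≤ R →
      |G x y - G 0 0| ≤ M * (|x| + |y|) := by
  obtain ⟨M₁, hM₁, h₁⟩ := exists_abs_le_of_continuous hGx R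
  obtain ⟨M₂, hM₂, h₂⟩ := exists_abs_le_of_continuous hGy R
  refine ⟨M₁ + M₂, by positivity, fun x y hx hy => ?_⟩
  have hd : ∀ t : ℝ, HasDerivAt (fun s : ℝ => G (s * x) (s * y))
      (Gx (t * x) (t * y) * x + Gy (t * x) (t * y) * y) t := fun t =>
    hG (by simpa using (hasDerivAt_id t).mul_const x) (by simpa using (hasDerivAt_id t).mul_const y)
  have := norm_image_sub_le_of_norm_deriv_le_segment_01' (C := (M₁ + M₂) * (|x| + |y|))
    (fun t _ => (hd t).hasDerivWithinAt) fun t ht => ?_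
  · simpa using this
  · have hs : ∀ {w : ℝ}, |w| ≤ R → |t * w| ≤ R := fun {w} hw => by
      rw [abs_mul, abs_of_nonneg ht.1]
      exact (mul_le_of_le_one_left (abs_nonneg _) ht.2.le).trans hw
    calc ‖Gx (t * x) (t * y) * x + Gy (t * x) (t * y) * y‖
        ≤ |Gx (t * x) (t * y)| * |x| + |Gy (t * x) (t * y)| * |y| := by
          refine (norm_add_le _ _).trans_eq ?_
          simp
      _ ≤ M₁ * |x| + M₂ * |y| := by
          gcongr
          · exact h₁ _ _ (hs hx) (hs hy)
          · exact h₂ _ _ (hs hx) (hs hy)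
      _ ≤ _ := by
          have := mul_nonneg hM₁ (abs_nonneg y)
          have := mul_nonneg hM₂ (abs_nonneg x)
          linarith

lemma one_add_norm_rpow_neg_le_one {E : Type*} [NormedAddCommGroup E] (x : E) (n : ℕ) :
    (1 + ‖x‖) ^ (-(n : ℝ)) ≤ 1 :=
  Real.rpow_le_one_of_one_le_of_nonpos (by linarith [norm_nonneg x]) (by simp)

variable {E : Type*} [NormedAddCommGroup E] [InnerProductSpace ℝ E] [FiniteDimensional ℝ E]
  [MeasurableSpace E] [BorelSpace E]

lemma hasLineDerivAt_heatExt (f : 𝓢(E, ℝ)) (s : ℝ) (x e : E) :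
    HasLineDerivAt ℝ (heatExt f s) (heatExt (∂_{e} f) s x) x e := by
  simpa [HasLineDerivAt] using hasDerivAt_heatExt_line f s x e 0

/-- On bounded ranges of scales the heat extension is dominated by a bounded integrable weight. -/
lemma exists_weight_abs_heatExt_le (f : 𝓢(E, ℝ)) (R : ℝ) : ∃ C : ℝ, 0 ≤ C ∧ ∀ s, |s| ≤ R → ∀ x,
    |heatExt f s x| ≤ C * (1 + ‖x‖) ^ (-((Module.finrank ℝ E + 1 : ℕ) : ℝ)) := by
  obtain ⟨C, hC, h⟩ := exists_one_add_norm_pow_mul_heatExt_le f (Module.finrank ℝ E + 1)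
  refine ⟨C * (1 + |R|) ^ (Module.finrank ℝ E + 1), by positivity, fun s hs x => ?_⟩
  rw [Real.rpow_neg (by positivity), Real.rpow_natCast, ← div_eq_mul_inv,
    le_div_iff₀ (by positivity), mul_comm]
  refine (h s x).trans ?_
  have : |s| ≤ |R| := hs.trans (le_abs_self R)
  gcongr

lemma exists_abs_heatExt_le_of_abs_le (f : 𝓢(E, ℝ)) (R : ℝ) :
    ∃ C : ℝ, 0 ≤ C ∧ ∀ s, |s| ≤ R → ∀ x, |heatExt f s x| ≤ C := by
  obtain ⟨C, hC, h⟩ := exists_weight_abs_heatExt_le f R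
  exact ⟨C, hC, fun s hs x => (h s hs x).trans
    (mul_le_of_le_one_right hC (one_add_norm_rpow_neg_le_one x _))⟩

lemma integrable_one_add_norm_rpow_neg : Integrable fun x : E =>
    (1 + ‖x‖) ^ (-((Module.finrank ℝ E + 1 : ℕ) : ℝ)) :=
  integrable_one_add_norm (by simp)

lemma continuous_comp_heatExt {G : ℝ → ℝ → ℝ} (hG : Continuous fun z : ℝ × ℝ => G z.1 z.2)
    (f g : 𝓢(E, ℝ)) (s : ℝ) : Continuous fun x => G (heatExt f s x) (heatExt g s x) :=
  hG.comp ((continuous_heatExt f s).prodMk (continuous_heatExt g s))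

lemma MeasureTheory.Integrable.mul_heatExt {φ : E → ℝ} (hφ : Integrable φ) (f : 𝓢(E, ℝ)) (s : ℝ) :
    Integrable fun x => φ x * heatExt f s x := by
  obtain ⟨C, -, h⟩ := exists_abs_heatExt_le_of_abs_le f |s|
  exact hφ.mul_bdd (continuous_heatExt f s).aestronglyMeasurable
    (.of_forall fun x => h s le_rfl x)

lemma integrable_comp_heatExt_mul {G : ℝ → ℝ → ℝ} (hG : Continuous fun z : ℝ × ℝ => G z.1 z.2)
    (f g h : 𝓢(E, ℝ)) (s : ℝ) :
    Integrable fun x => G (heatExt f s x) (heatExt g s x) * heatExt h s x := by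
  obtain ⟨C₁, -, h₁⟩ := exists_abs_heatExt_le_of_abs_le f |s|
  obtain ⟨C₂, -, h₂⟩ := exists_abs_heatExt_le_of_abs_le g |s|
  obtain ⟨M, -, hM⟩ := exists_abs_le_of_continuous hG (max C₁ C₂)
  exact (integrable_heatExt h s).bdd_mul (continuous_comp_heatExt hG f g s).aestronglyMeasurable
    (.of_forall fun x => hM _ _ ((h₁ s le_rfl x).trans (le_max_left _ _))
      ((h₂ s le_rfl x).trans (le_max_right _ _)))

lemma integrable_comp_heatExt_sub {G Gx Gy : ℝ → ℝ → ℝ}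
    (hG : ∀ {u v : ℝ → ℝ} {u' v' t : ℝ}, HasDerivAt u u' t → HasDerivAt v v' t →
      HasDerivAt (fun s => G (u s) (v s)) (Gx (u t) (v t) * u' + Gy (u t) (v t) * v') t)
    (hG₀ : Continuous fun z : ℝ × ℝ => G z.1 z.2)
    (hGx : Continuous fun z : ℝ × ℝ => Gx z.1 z.2) (hGy : Continuous fun z : ℝ × ℝ => Gy z.1 z.2)
    (f g : 𝓢(E, ℝ)) (s : ℝ) :
    Integrable fun x => G (heatExt f s x) (heatExt g s x) - G 0 0 := by
  obtain ⟨C₁, -, h₁⟩ := exists_abs_heatExt_le_of_abs_le f |s|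
  obtain ⟨C₂, -, h₂⟩ := exists_abs_heatExt_le_of_abs_le g |s|
  obtain ⟨M, -, hM⟩ := exists_abs_sub_le_of_hasDerivAt hG hGx hGy (max C₁ C₂)
  refine (((integrable_heatExt f s).abs.add (integrable_heatExt g s).abs).const_mul M).mono'
    ((continuous_comp_heatExt hG₀ f g s).sub continuous_const).aestronglyMeasurable
    (.of_forall fun x => ?_)
  exact hM _ _ ((h₁ s le_rfl x).trans (le_max_left _ _)) ((h₂ s le_rfl x).trans (le_max_right _ _))

lemma hasDerivAt_integral_comp_heatExt {G Gx Gy : ℝ → ℝ → ℝ}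
    (hG : ∀ {u v : ℝ → ℝ} {u' v' t : ℝ}, HasDerivAt u u' t → HasDerivAt v v' t →
      HasDerivAt (fun s => G (u s) (v s)) (Gx (u t) (v t) * u' + Gy (u t) (v t) * v') t)
    (hG₀ : Continuous fun z : ℝ × ℝ => G z.1 z.2)
    (hGx : Continuous fun z : ℝ × ℝ => Gx z.1 z.2) (hGy : Continuous fun z : ℝ × ℝ => Gy z.1 z.2)
    (f g : 𝓢(E, ℝ)) (s : ℝ) :
    HasDerivAt (fun s => ∫ x, (G (heatExt f s x) (heatExt g s x) - G 0 0))
      (s * (∫ x, Gx (heatExt f s x) (heatExt g s x) * heatExt (Δ f) s x +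
        Gy (heatExt f s x) (heatExt g s x) * heatExt (Δ g) s x)) s := by
  obtain ⟨C₁, -, h₁⟩ := exists_abs_heatExt_le_of_abs_le f (|s| + 1)
  obtain ⟨C₂, -, h₂⟩ := exists_abs_heatExt_le_of_abs_le g (|s| + 1)
  obtain ⟨C₃, hC₃, h₃⟩ := exists_weight_abs_heatExt_le (Δ f) (|s| + 1)
  obtain ⟨C₄, hC₄, h₄⟩ := exists_weight_abs_heatExt_le (Δ g) (|s| + 1)
  obtain ⟨M₁, hM₁, hx⟩ := exists_abs_le_of_continuous hGx (max C₁ C₂)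
  obtain ⟨M₂, hM₂, hy⟩ := exists_abs_le_of_continuous hGy (max C₁ C₂)
  have hdiff : ∀ (t : ℝ) (x : E), HasDerivAt
      (fun s => G (heatExt f s x) (heatExt g s x) - G 0 0)
      (Gx (heatExt f t x) (heatExt g t x) * (t * heatExt (Δ f) t x) +
        Gy (heatExt f t x) (heatExt g t x) * (t * heatExt (Δ g) t x)) t := fun t x =>
    (hG (hasDerivAt_heatExt f x t) (hasDerivAt_heatExt g x t)).sub_const _
  have key := (hasDerivAt_integral_of_dominated_loc_of_deriv_le (μ := (volume : Measure E))
    (s := Metric.ball s 1) (x₀ := s)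
    (F := fun s x => G (heatExt f s x) (heatExt g s x) - G 0 0)
    (F' := fun t x => Gx (heatExt f t x) (heatExt g t x) * (t * heatExt (Δ f) t x) +
        Gy (heatExt f t x) (heatExt g t x) * (t * heatExt (Δ g) t x))
    (bound := fun x => (|s| + 1) * (M₁ * C₃ + M₂ * C₄) *
      (1 + ‖x‖) ^ (-((Module.finrank ℝ E + 1 : ℕ) : ℝ)))
    (Metric.ball_mem_nhds s one_pos)
    (.of_forall fun t => (integrable_comp_heatExt_sub hG hG₀ hGx hGy f g t).aestronglyMeasurable)
    (integrable_comp_heatExt_sub hG hG₀ hGx hGy f g s) ?_ ?_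
    (integrable_one_add_norm_rpow_neg.const_mul _) (.of_forall fun x t _ => hdiff t x)).2
  · refine key.congr_deriv ?_
    rw [← integral_const_mul]
    refine integral_congr_ae (.of_forall fun x => ?_)
    simp only
    ring
  · have c1 := continuous_comp_heatExt hGx f g s
    have c2 := continuous_comp_heatExt hGy f g s
    have c3 := continuous_heatExt (Δ f) s
    have c4 := continuous_heatExt (Δ g) s
    exact ((c1.mul (c3.const_mul s)).add (c2.mul (c4.const_mul s))).aestronglyMeasurable
  · refine .of_forall fun x t ht => ?_
    have ht' : |t| ≤ |s| + 1 := by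
      have h1 : |t - s| < 1 := by simpa [Real.dist_eq] using ht
      have := abs_sub_abs_le_abs_sub t s
      linarith
    have b1 := (h₁ t ht' x).trans (le_max_left C₁ C₂)
    have b2 := (h₂ t ht' x).trans (le_max_right C₁ C₂)
    have b3 := h₃ t ht' x
    have b4 := h₄ t ht' x
    set w := (1 + ‖x‖) ^ (-((Module.finrank ℝ E + 1 : ℕ) : ℝ))
    calc _ ≤ |Gx (heatExt f t x) (heatExt g t x)| * (|t| * |heatExt (Δ f) t x|) +
          |Gy (heatExt f t x) (heatExt g t x)| * (|t| * |heatExt (Δ g) t x|) := by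
          refine (norm_add_le _ _).trans_eq ?_
          simp only [Real.norm_eq_abs, abs_mul]
      _ ≤ M₁ * ((|s| + 1) * (C₃ * w)) + M₂ * ((|s| + 1) * (C₄ * w)) := by
          gcongr
          · exact hx _ _ b1 b2
          · exact hy _ _ b1 b2
      _ = _ := by ring

lemma integral_mul_heatExt_lineDeriv {φ φ' : E → ℝ} {e : E} (f : 𝓢(E, ℝ)) (s : ℝ)
    (hφ : ∀ x, HasLineDerivAt ℝ φ (φ' x) x e)
    (h₁ : Integrable fun x => φ' x * heatExt f s x)
    (h₂ : Integrable fun x => φ x * heatExt (∂_{e} f) s x)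
    (h₃ : Integrable fun x => φ x * heatExt f s x) :
    ∫ x, φ x * heatExt (∂_{e} f) s x = -∫ x, φ' x * heatExt f s x :=
  integral_bilinear_hasLineDerivAt_right_eq_neg_left_of_integrable (μ := (volume : Measure E))
    (B := ContinuousLinearMap.mul ℝ ℝ) h₁ h₂ h₃ (fun x _ => hφ x)
    (fun x _ => hasLineDerivAt_heatExt f s x e)

lemma integral_heatExt_mul_heatExt_lineDeriv (f g : 𝓢(E, ℝ)) (s : ℝ) (e : E) :
    ∫ x, heatExt f s x * heatExt (∂_{e} g) s x = -∫ x, heatExt (∂_{e} f) s x * heatExt g s x :=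
  integral_mul_heatExt_lineDeriv g s (fun x => hasLineDerivAt_heatExt f s x e)
    ((integrable_heatExt _ s).mul_heatExt _ s) ((integrable_heatExt _ s).mul_heatExt _ s)
    ((integrable_heatExt _ s).mul_heatExt _ s)

lemma integral_heatExt_mul_heatExt_laplacian (f g : 𝓢(E, ℝ)) (s : ℝ) :
    ∫ x, heatExt f s x * heatExt (Δ g) s x = ∫ x, heatExt (Δ f) s x * heatExt g s x := by
  have b := stdOrthonormalBasis ℝ E
  simp only [laplacian_eq_sum b, heatExt_sum, Finset.mul_sum, Finset.sum_mul]
  rw [integral_finsetSum _ fun i _ => (integrable_heatExt _ s).mul_heatExt _ s,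
    integral_finsetSum _ fun i _ => (integrable_heatExt _ s).mul_heatExt _ s]
  refine Finset.sum_congr rfl fun i _ => ?_
  rw [integral_heatExt_mul_heatExt_lineDeriv, integral_heatExt_mul_heatExt_lineDeriv, neg_neg]

end HeatFlowMonotonicity

section HeatFlowMonotonicity

open SchwartzMap LineDeriv Laplacian

variable {E : Type*} [NormedAddCommGroup E] [InnerProductSpace ℝ E] [FiniteDimensional ℝ E]
  [MeasurableSpace E] [BorelSpace E]

/-- The Hessian of `B` at `(f, g)` (extended by the heat flow), evaluated at the derivatives of
`f` and `g` in direction `e`. -/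
noncomputable def BellmanFunction.heatHessian (B : BellmanFunction) (f g : 𝓢(E, ℝ)) (s : ℝ)
    (e x : E) : ℝ :=
  B.dxx (heatExt f s x) (heatExt g s x) * heatExt (∂_{e} f) s x ^ 2 +
    2 * B.dxy (heatExt f s x) (heatExt g s x) *
      (heatExt (∂_{e} f) s x * heatExt (∂_{e} g) s x) +
    B.dyy (heatExt f s x) (heatExt g s x) * heatExt (∂_{e} g) s x ^ 2

namespace BellmanFunction

variable (B : BellmanFunction) (f g : 𝓢(E, ℝ)) (s : ℝ)

lemma integral_dx_mul_lineDeriv (h : 𝓢(E, ℝ)) (e : E) :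
    ∫ x, B.dx (heatExt f s x) (heatExt g s x) * heatExt (∂_{e} h) s x =
      -∫ x, (B.dxx (heatExt f s x) (heatExt g s x) * heatExt (∂_{e} f) s x +
        B.dxy (heatExt f s x) (heatExt g s x) * heatExt (∂_{e} g) s x) * heatExt h s x :=
  integral_mul_heatExt_lineDeriv h s
    (fun x => by
      simpa [HasLineDerivAt] using B.hasDerivAt_dx (hasLineDerivAt_heatExt f s x e)
        (hasLineDerivAt_heatExt g s x e))
    (((integrable_comp_heatExt_mul B.continuous_dxx f g _ s).add
      (integrable_comp_heatExt_mul B.continuous_dxy f g _ s)).mul_heatExt h s)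
    (integrable_comp_heatExt_mul B.continuous_dx f g _ s)
    (integrable_comp_heatExt_mul B.continuous_dx f g _ s)

lemma integral_dy_mul_lineDeriv (h : 𝓢(E, ℝ)) (e : E) :
    ∫ x, B.dy (heatExt f s x) (heatExt g s x) * heatExt (∂_{e} h) s x =
      -∫ x, (B.dxy (heatExt f s x) (heatExt g s x) * heatExt (∂_{e} f) s x +
        B.dyy (heatExt f s x) (heatExt g s x) * heatExt (∂_{e} g) s x) * heatExt h s x :=
  integral_mul_heatExt_lineDeriv h s
    (fun x => by
      simpa [HasLineDerivAt] using B.hasDerivAt_dy (hasLineDerivAt_heatExt f s x e)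
        (hasLineDerivAt_heatExt g s x e))
    (((integrable_comp_heatExt_mul B.continuous_dxy f g _ s).add
      (integrable_comp_heatExt_mul B.continuous_dyy f g _ s)).mul_heatExt h s)
    (integrable_comp_heatExt_mul B.continuous_dy f g _ s)
    (integrable_comp_heatExt_mul B.continuous_dy f g _ s)

lemma integrable_heatHessian (e : E) : Integrable (B.heatHessian f g s e) := by
  refine ((((integrable_comp_heatExt_mul B.continuous_dxx f g (∂_{e} f) s).mul_heatExt
    (∂_{e} f) s).add (((integrable_comp_heatExt_mul B.continuous_dxy f g (∂_{e} f) s).mul_heatExt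
    (∂_{e} g) s).const_mul 2)).add ((integrable_comp_heatExt_mul B.continuous_dyy f g
    (∂_{e} g) s).mul_heatExt (∂_{e} g) s)).congr (.of_forall fun x => ?_)
  simp only [heatHessian, Pi.add_apply]
  ring

lemma integral_heatHessian (e : E) : ∫ x, (B.dx (heatExt f s x) (heatExt g s x) *
      heatExt (∂_{e} (∂_{e} f)) s x +
    B.dy (heatExt f s x) (heatExt g s x) * heatExt (∂_{e} (∂_{e} g)) s x) =
      -∫ x, B.heatHessian f g s e x := by
  rw [integral_add (integrable_comp_heatExt_mul B.continuous_dx f g _ s)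
    (integrable_comp_heatExt_mul B.continuous_dy f g _ s), integral_dx_mul_lineDeriv,
    integral_dy_mul_lineDeriv, ← neg_add, ← integral_add]
  · congr 1
    refine integral_congr_ae (.of_forall fun x => ?_)
    simp only [heatHessian]
    ring
  · exact ((integrable_comp_heatExt_mul B.continuous_dxx f g _ s).add
      (integrable_comp_heatExt_mul B.continuous_dxy f g _ s)).mul_heatExt _ s
  · exact ((integrable_comp_heatExt_mul B.continuous_dxy f g _ s).add
      (integrable_comp_heatExt_mul B.continuous_dyy f g _ s)).mul_heatExt _ s

lemma integral_laplacian_eq {ι : Type*} [Fintype ι] (b : OrthonormalBasis ι ℝ E) :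
    ∫ x, (B.dx (heatExt f s x) (heatExt g s x) * heatExt (Δ f) s x +
      B.dy (heatExt f s x) (heatExt g s x) * heatExt (Δ g) s x) =
      -∫ x, ∑ k, B.heatHessian f g s (b k) x := by
  rw [integral_finsetSum _ fun k _ => B.integrable_heatHessian f g s (b k),
    ← Finset.sum_neg_distrib]
  simp only [← integral_heatHessian, laplacian_eq_sum b, heatExt_sum, Finset.mul_sum]
  rw [← integral_finsetSum]
  · simp only [Finset.sum_add_distrib]
  · exact fun i _ => (integrable_comp_heatExt_mul B.continuous_dx f g _ s).add
      (integrable_comp_heatExt_mul B.continuous_dy f g _ s)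

lemma two_mul_abs_le_sum_heatHessian {ι : Type*} [Fintype ι] (e : ι → E) (i j : ι) (x : E) :
    2 * |heatExt (∂_{e j} f) s x * heatExt (∂_{e i} g) s x| ≤
      ∑ k, B.heatHessian f g s (e k) x := by
  obtain ⟨τ, hτ, h⟩ := B.coercive (heatExt f s x) (heatExt g s x)
  have hi : ∀ k, τ⁻¹ * heatExt (∂_{e k} g) s x ^ 2 ≤
      τ * heatExt (∂_{e k} f) s x ^ 2 + τ⁻¹ * heatExt (∂_{e k} g) s x ^ 2 := fun k =>
    le_add_of_nonneg_left (by positivity)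
  calc 2 * |heatExt (∂_{e j} f) s x * heatExt (∂_{e i} g) s x|
      ≤ τ * heatExt (∂_{e j} f) s x ^ 2 + τ⁻¹ * heatExt (∂_{e i} g) s x ^ 2 := by
        rw [abs_mul, ← sq_abs (heatExt (∂_{e j} f) s x), ← sq_abs (heatExt (∂_{e i} g) s x)]
        set a := |heatExt (∂_{e j} f) s x|
        set c := |heatExt (∂_{e i} g) s x|
        have h1 : 0 ≤ τ * (a - τ⁻¹ * c) ^ 2 := by positivity
        have h2 : τ * (a - τ⁻¹ * c) ^ 2 = τ * a ^ 2 + τ⁻¹ * c ^ 2 - 2 * (a * c) := by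
          field_simp
          ring
        linarith
    _ ≤ ∑ k, τ * heatExt (∂_{e k} f) s x ^ 2 + ∑ k, τ⁻¹ * heatExt (∂_{e k} g) s x ^ 2 :=
        add_le_add
          (Finset.single_le_sum (f := fun k => τ * heatExt (∂_{e k} f) s x ^ 2)
            (fun k _ => by positivity) (Finset.mem_univ j))
          (Finset.single_le_sum (f := fun k => τ⁻¹ * heatExt (∂_{e k} g) s x ^ 2)
            (fun k _ => by positivity) (Finset.mem_univ i))
    _ ≤ _ := by
        rw [← Finset.sum_add_distrib]
        exact Finset.sum_le_sum fun k _ => h _ _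

/-- The excess of `B` along the heat flow. -/
noncomputable def heatEnergy : ℝ :=
  ∫ x, (B.toFun (heatExt f s x) (heatExt g s x) - B.toFun 0 0)

lemma heatEnergy_nonneg : 0 ≤ B.heatEnergy f g s :=
  integral_nonneg fun _ => sub_nonneg.2 (B.zero_le _ _)

lemma hasDerivAt_heatEnergy {ι : Type*} [Fintype ι] (b : OrthonormalBasis ι ℝ E) :
    HasDerivAt (B.heatEnergy f g) (-(s * ∫ x, ∑ k, B.heatHessian f g s (b k) x)) s := by
  have := hasDerivAt_integral_comp_heatExt B.hasDerivAt_toFun B.continuous_toFun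
    B.continuous_dx B.continuous_dy f g s
  rwa [B.integral_laplacian_eq f g s b, mul_neg] at this

end BellmanFunction

lemma hasDerivAt_integral_heatExt_mul (h g : 𝓢(E, ℝ)) (s : ℝ) :
    HasDerivAt (fun s => ∫ x, heatExt h s x * heatExt g s x)
      (2 * s * ∫ x, heatExt (Δ h) s x * heatExt g s x) s := by
  have := hasDerivAt_integral_comp_heatExt (G := fun x y => x * y) (Gx := fun _ y => y)
    (Gy := fun x _ => x) (fun hu hv => (hu.mul hv).congr_deriv (by ring)) (by fun_prop)
    (by fun_prop) (by fun_prop) h g s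
  simp only [mul_zero, sub_zero] at this
  refine this.congr_deriv ?_
  rw [integral_add ((integrable_heatExt _ s).mul_heatExt _ s)
    ((integrable_heatExt _ s).mul_heatExt _ s), integral_heatExt_mul_heatExt_laplacian h g]
  simp only [mul_comm (heatExt g s _)]
  ring

lemma tendsto_integral_heatExt_mul [Nontrivial E] (h g : 𝓢(E, ℝ)) :
    Filter.Tendsto (fun s => ∫ x, heatExt h s x * heatExt g s x) Filter.atTop (nhds 0) := by
  obtain ⟨C, hC⟩ := exists_abs_heatExt_le h
  have hlim : Filter.Tendsto (fun s : ℝ => C * (s ^ Module.finrank ℝ E)⁻¹ * ∫ x, |g x|)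
      Filter.atTop (nhds 0) := by
    have := ((Filter.tendsto_pow_atTop (α := ℝ)
      (Module.finrank_pos (R := ℝ) (M := E)).ne').inv_tendsto_atTop.const_mul C).mul_const
      (∫ x, |g x|)
    simpa using this
  refine squeeze_zero_norm' ?_ hlim
  filter_upwards [Filter.eventually_gt_atTop 0] with s hs
  have h0 : 0 ≤ C * (s ^ Module.finrank ℝ E)⁻¹ := (abs_nonneg _).trans (hC s hs 0)
  calc ‖∫ x, heatExt h s x * heatExt g s x‖ ≤ ∫ x, |heatExt h s x * heatExt g s x| :=
        abs_integral_le_integral_abs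
    _ ≤ ∫ x, C * (s ^ Module.finrank ℝ E)⁻¹ * |heatExt g s x| := by
        refine integral_mono ((integrable_heatExt _ s).mul_heatExt _ s).abs
          ((integrable_heatExt g s).abs.const_mul _) fun x => ?_
        simp only [abs_mul]
        exact mul_le_mul_of_nonneg_right (hC s hs x) (abs_nonneg _)
    _ ≤ _ := by
        rw [integral_const_mul]
        exact mul_le_mul_of_nonneg_left (integral_abs_heatExt_le g s) h0

/-- The bilinear embedding: the pairing of `h` with `g` is controlled by a Bellman function
whenever `Δ h` is a sum of second derivatives of the functions `F l`. -/
theorem abs_integral_mul_le_sum_heatEnergy [Nontrivial E] {ι κ : Type*} [Fintype ι] [Fintype κ]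
    (b : OrthonormalBasis ι ℝ E) (B : BellmanFunction) (h g : 𝓢(E, ℝ)) (i j : κ → ι)
    (F : κ → 𝓢(E, ℝ)) (hF : Δ h = ∑ l, ∂_{b (i l)} (∂_{b (j l)} (F l))) :
    |∫ x, h x * g x| ≤ ∑ l, ∫ x, (B.toFun (F l x) (g x) - B.toFun 0 0) := by
  set I : ℝ → ℝ := fun s => ∫ x, heatExt h s x * heatExt g s x
  have hder : ∀ s, ∫ x, heatExt (Δ h) s x * heatExt g s x =
      -∑ l, ∫ x, heatExt (∂_{b (j l)} (F l)) s x * heatExt (∂_{b (i l)} g) s x := fun s => by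
    rw [hF]
    simp only [heatExt_sum, Finset.sum_mul]
    rw [integral_finsetSum _ fun l _ => (integrable_heatExt _ s).mul_heatExt _ s,
      ← Finset.sum_neg_distrib]
    refine Finset.sum_congr rfl fun l _ => ?_
    rw [integral_heatExt_mul_heatExt_lineDeriv, neg_neg]
  have hbound : ∀ s, 2 * |∫ x, heatExt (Δ h) s x * heatExt g s x| ≤
      ∑ l, ∫ x, ∑ k, B.heatHessian (F l) g s (b k) x := fun s => by
    rw [hder, abs_neg]
    refine (mul_le_mul_of_nonneg_left (Finset.abs_sum_le_sum_abs _ _) zero_le_two).trans ?_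
    rw [Finset.mul_sum]
    refine Finset.sum_le_sum fun l _ => ?_
    refine (mul_le_mul_of_nonneg_left abs_integral_le_integral_abs zero_le_two).trans ?_
    rw [← integral_const_mul]
    exact integral_mono (((integrable_heatExt _ s).mul_heatExt _ s).abs.const_mul 2)
      (integrable_finsetSum _ fun k _ => B.integrable_heatHessian (F l) g s (b k))
      fun x => B.two_mul_abs_le_sum_heatHessian (F l) g s b (i l) (j l) x
  have main : ∀ ε : ℝ, |ε| = 1 → 0 ≤ ∑ l, B.heatEnergy (F l) g 0 + ε * I 0 := fun ε hε => by
    have hJ : ∀ s, HasDerivAt (fun s => ∑ l, B.heatEnergy (F l) g s + ε * I s)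
        (∑ l, -(s * ∫ x, ∑ k, B.heatHessian (F l) g s (b k) x) +
          ε * (2 * s * ∫ x, heatExt (Δ h) s x * heatExt g s x)) s := fun s =>
      (HasDerivAt.fun_sum fun l _ => B.hasDerivAt_heatEnergy (F l) g s b).add
        ((hasDerivAt_integral_heatExt_mul h g s).const_mul ε)
    have hanti : AntitoneOn (fun s => ∑ l, B.heatEnergy (F l) g s + ε * I s) (Set.Ici 0) := by
      refine antitoneOn_of_deriv_nonpos (convex_Ici 0)
        (fun s _ => (hJ s).continuousAt.continuousWithinAt)
        (fun s _ => (hJ s).differentiableAt.differentiableWithinAt) fun s hs => ?_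
      rw [interior_Ici, Set.mem_Ioi] at hs
      rw [(hJ s).deriv, Finset.sum_neg_distrib, ← Finset.mul_sum]
      have h1 : ε * ∫ x, heatExt (Δ h) s x * heatExt g s x ≤
          |∫ x, heatExt (Δ h) s x * heatExt g s x| := by
        refine (le_abs_self _).trans_eq ?_
        rw [abs_mul, hε, one_mul]
      have h2 := mul_le_mul_of_nonneg_left (hbound s) hs.le
      have h3 := mul_le_mul_of_nonneg_left h1 hs.le
      linarith
    have hlim := (tendsto_integral_heatExt_mul h g).const_mul ε
    rw [mul_zero] at hlim
    refine le_of_tendsto hlim ?_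
    filter_upwards [Filter.eventually_ge_atTop 0] with s hs
    refine le_trans ?_ (hanti Set.self_mem_Ici hs hs)
    exact le_add_of_nonneg_left (Finset.sum_nonneg fun l _ => B.heatEnergy_nonneg (F l) g s)
  have h₁ := main 1 (by simp)
  have h₂ := main (-1) (by simp)
  simp only [I, BellmanFunction.heatEnergy, heatExt_zero] at h₁ h₂
  exact abs_le.2 ⟨by linarith, by linarith⟩

end HeatFlowMonotonicity

lemma MeasureTheory.MemLp.norm_toLp_rpow {α : Type*} [MeasurableSpace α] {μ : Measure α} {q : ℝ}
    (hq : 0 < q) {f : α → ℝ} (hf : MemLp f (ENNReal.ofReal q) μ) :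
    ‖hf.toLp f‖ ^ q = ∫ x, |f x| ^ q ∂μ := by
  have h0 : 0 ≤ ∫ x, |f x| ^ q ∂μ := integral_nonneg fun x => by positivity
  rw [Lp.norm_toLp, hf.eLpNorm_eq_integral_rpow_norm (by simpa using hq) ENNReal.ofReal_ne_top,
    ENNReal.toReal_ofReal hq.le]
  simp only [Real.norm_eq_abs]
  rw [ENNReal.toReal_ofReal (by positivity), ← Real.rpow_mul h0, inv_mul_cancel₀ hq.ne',
    Real.rpow_one]

section SecondOrderEstimate

open SchwartzMap LineDeriv Laplacian

variable {E : Type*} [NormedAddCommGroup E] [InnerProductSpace ℝ E] [FiniteDimensional ℝ E]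
  [MeasurableSpace E] [BorelSpace E]

lemma SchwartzMap.integrable_abs_rpow (f : 𝓢(E, ℝ)) {p : ℝ} (hp : 0 < p) :
    Integrable fun x => |f x| ^ p := by
  simpa [ENNReal.toReal_ofReal hp.le] using (f.memLp (ENNReal.ofReal p)).integrable_norm_rpow
    (by simpa using hp) ENNReal.ofReal_ne_top

/-- The bilinear embedding for the power functions. -/
theorem exists_abs_integral_mul_le [Nontrivial E] {ι : Type*} [Fintype ι]
    (b : OrthonormalBasis ι ℝ E) {p q : ℝ} (hpq : p.HolderConjugate q) :
    ∃ C : ℝ, 0 < C ∧ ∀ {κ : Type} [Fintype κ] (h g : 𝓢(E, ℝ)) (i j : κ → ι) (F : κ → 𝓢(E, ℝ)),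
      Δ h = ∑ l, ∂_{b (i l)} (∂_{b (j l)} (F l)) →
      |∫ x, h x * g x| ≤ C * ∑ l, ((∫ x, |F l x| ^ p) + ∫ x, |g x| ^ q) := by
  obtain ⟨C, hC, hB⟩ := BellmanFunction.exists_of_holderConjugate hpq
  refine ⟨C, hC, fun {κ} _ h g i j F hF => ?_⟩
  have key : ∀ δ : ℝ, 0 < δ → |∫ x, h x * g x| ≤
      C * ∑ l, ((∫ x, |F l x| ^ p) + ∫ x, |g x| ^ q) +
        δ * ∑ l, ((∫ x, F l x ^ 2) + ∫ x, g x ^ 2) := fun δ hδ => by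
    obtain ⟨B, hB⟩ := hB δ hδ
    refine (abs_integral_mul_le_sum_heatEnergy b B h g i j F hF).trans ?_
    rw [Finset.mul_sum, Finset.mul_sum, ← Finset.sum_add_distrib]
    refine Finset.sum_le_sum fun l _ => ?_
    have i1 := (F l).integrable_abs_rpow hpq.pos
    have i2 := g.integrable_abs_rpow hpq.symm.pos
    have i3 := ((F l).memLp 2 (volume : Measure E)).integrable_sq
    have i4 := (g.memLp 2 (volume : Measure E)).integrable_sq
    have i5 : Integrable fun x => C * (|F l x| ^ p + |g x| ^ q) := (i1.add i2).const_mul C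
    have i6 : Integrable fun x => δ * (F l x ^ 2 + g x ^ 2) := (i3.add i4).const_mul δ
    rw [← integral_add i1 i2, ← integral_add i3 i4, ← integral_const_mul, ← integral_const_mul,
      ← integral_add i5 i6]
    exact integral_mono_of_nonneg (.of_forall fun x => sub_nonneg.2 (B.zero_le _ _))
      (i5.add i6) (.of_forall fun x => hB _ _)
  have hlim : Filter.Tendsto (fun δ : ℝ => C * ∑ l, ((∫ x, |F l x| ^ p) + ∫ x, |g x| ^ q) +
      δ * ∑ l, ((∫ x, F l x ^ 2) + ∫ x, g x ^ 2)) (nhdsWithin 0 (Set.Ioi 0))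
      (nhds (C * ∑ l, ((∫ x, |F l x| ^ p) + ∫ x, |g x| ^ q) +
        0 * ∑ l, ((∫ x, F l x ^ 2) + ∫ x, g x ^ 2))) := by
    refine Filter.Tendsto.mono_left (Continuous.tendsto ?_ 0) nhdsWithin_le_nhds
    fun_prop
  rw [zero_mul, add_zero] at hlim
  exact ge_of_tendsto hlim (eventually_mem_nhdsWithin.mono fun δ hδ => key δ hδ)

/-- An `L^p` bound by duality: it suffices to test against Schwartz functions. -/
theorem integral_abs_rpow_le_of_forall_schwartz {p q : ℝ} (hpq : p.HolderConjugate q)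
    (h : 𝓢(E, ℝ)) {A D : ℝ}
    (H : ∀ g : 𝓢(E, ℝ), |∫ x, h x * g x| ≤ A + D * ∫ x, |g x| ^ q) :
    ∫ x, |h x| ^ p ≤ A + D * ∫ x, |h x| ^ p := by
  have hp := hpq.pos
  have hq := hpq.symm.pos
  have : ENNReal.HolderConjugate (ENNReal.ofReal p) (ENNReal.ofReal q) := hpq.ennrealOfReal
  have hp1 : Fact (1 ≤ ENNReal.ofReal p) := ⟨by simpa using hpq.lt.le⟩
  have hq1 : Fact (1 ≤ ENNReal.ofReal q) := ⟨by simpa using hpq.symm.lt.le⟩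
  have hmem := h.memLp (ENNReal.ofReal p) (volume : Measure E)
  have all : ∀ ψ : Lp ℝ (ENNReal.ofReal q) (volume : Measure E),
      |(ContinuousLinearMap.mul ℝ ℝ).lpPairing volume (ENNReal.ofReal p) (ENNReal.ofReal q)
        (hmem.toLp h) ψ| ≤ A + D * ‖ψ‖ ^ q := by
    refine fun ψ => DenseRange.induction_on (p := fun ψ =>
        |(ContinuousLinearMap.mul ℝ ℝ).lpPairing volume (ENNReal.ofReal p) (ENNReal.ofReal q)
          (hmem.toLp h) ψ| ≤ A + D * ‖ψ‖ ^ q)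
      (SchwartzMap.denseRange_toLpCLM (F := ℝ) ENNReal.ofReal_ne_top) ψ
      (isClosed_le ?_ ?_) fun g => ?_
    · fun_prop
    · have := hq.le
      fun_prop (disch := assumption)
    · rw [ContinuousLinearMap.lpPairing_eq_integral]
      have e1 : ‖SchwartzMap.toLpCLM ℝ ℝ (ENNReal.ofReal q) volume g‖ ^ q = ∫ x, |g x| ^ q :=
        (g.memLp (ENNReal.ofReal q) (volume : Measure E)).norm_toLp_rpow hq
      rw [e1]
      refine le_of_eq_of_le (congrArg _ (integral_congr_ae ?_)) (H g)
      filter_upwards [hmem.coeFn_toLp, g.coeFn_toLp (ENNReal.ofReal q) volume] with x h1 h2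
      simp only [ContinuousLinearMap.mul_apply', h1]
      exact congrArg _ h2
  set φ : E → ℝ := fun x => h x * |h x| ^ (p - 2) with hφ
  have hφh : ∀ x, h x * φ x = |h x| ^ p := fun x => by
    rcases eq_or_ne (h x) 0 with h0 | h0
    · simp [hφ, h0, hp.ne']
    · have : 0 < |h x| := abs_pos.2 h0
      simp only [hφ]
      rw [← mul_assoc, ← abs_mul_abs_self, Real.rpow_sub this, Real.rpow_two]
      field_simp
  have hφq : ∀ x, |φ x| ^ q = |h x| ^ p := fun x => by
    rcases eq_or_ne (h x) 0 with h0 | h0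
    · simp [hφ, h0, hp.ne', hq.ne']
    · have : 0 < |h x| := abs_pos.2 h0
      have e : |φ x| = |h x| ^ (p - 1) := by
        simp only [hφ]
        rw [abs_mul, abs_of_nonneg (by positivity : 0 ≤ |h x| ^ (p - 2)), ← Real.rpow_one_add'
          this.le (by linarith [hpq.lt])]
        congr 1
        ring
      rw [e, ← Real.rpow_mul this.le, hpq.sub_one_mul_conj]
  have hφmeas : AEStronglyMeasurable φ (volume : Measure E) :=
    (h.continuous.measurable.mul
      ((h.continuous.measurable.norm).pow_const (p - 2))).aestronglyMeasurable
  have hφmem : MemLp φ (ENNReal.ofReal q) (volume : Measure E) := by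
    rw [← integrable_norm_rpow_iff hφmeas (by simpa using hq) ENNReal.ofReal_ne_top,
      ENNReal.toReal_ofReal hq.le]
    simpa only [Real.norm_eq_abs, hφq] using h.integrable_abs_rpow hp
  have := all (hφmem.toLp φ)
  rw [hφmem.norm_toLp_rpow hq, ContinuousLinearMap.lpPairing_eq_integral] at this
  simp only [hφq] at this
  refine le_of_eq_of_le ?_ ((le_abs_self _).trans this)
  refine integral_congr_ae ?_
  filter_upwards [hmem.coeFn_toLp, hφmem.coeFn_toLp] with x h1 h2
  simp only [ContinuousLinearMap.mul_apply', h1, h2, hφh]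

/-- The `L^p` estimate for second order Riesz transforms, in the form: if `Δ h` is a sum of second
derivatives of the functions `F l`, then `h` is bounded by the `F l` in `L^p`. -/
theorem exists_eLpNorm_le_of_laplacian_eq_sum [Nontrivial E] {ι : Type*} [Fintype ι]
    (b : OrthonormalBasis ι ℝ E) {p : ℝ} (hp : 1 < p) (κ : Type) [Fintype κ] :
    ∃ C : NNReal, ∀ (h : 𝓢(E, ℝ)) (i j : κ → ι) (F : κ → 𝓢(E, ℝ)) (M : ENNReal),
      Δ h = ∑ l, ∂_{b (i l)} (∂_{b (j l)} (F l)) →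
      (∀ l, eLpNorm (F l) (ENNReal.ofReal p) volume ≤ M) →
      eLpNorm h (ENNReal.ofReal p) volume ≤ C * M := by
  have hpq : p.HolderConjugate _ := Real.HolderConjugate.conjExponent hp
  set q := p.conjExponent
  obtain ⟨C, hC, H⟩ := exists_abs_integral_mul_le b hpq
  set n : ℝ := (Fintype.card κ : ℝ) with hn
  set μ : ℝ := 2 * C * (n + 1) with hμ'
  have hn0 : 0 ≤ n := Nat.cast_nonneg _
  have hμ : 0 < μ := by positivity
  have hp0 : 0 < p := by linarith
  refine ⟨μ.toNNReal, fun h i j F M hF hM => ?_⟩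
  rcases eq_or_ne M ⊤ with rfl | hMt
  · simp [ENNReal.mul_top, hμ]
  lift M to NNReal using hMt
  have hN : ∀ f : 𝓢(E, ℝ), eLpNorm f (ENNReal.ofReal p) volume =
      ENNReal.ofReal ((∫ x, |f x| ^ p) ^ p⁻¹) := fun f => by
    rw [MemLp.eLpNorm_eq_integral_rpow_norm (by simpa using hp0) ENNReal.ofReal_ne_top
      (f.memLp (ENNReal.ofReal p) volume), ENNReal.toReal_ofReal hp0.le]
    simp only [Real.norm_eq_abs]
  have hI : ∀ f : 𝓢(E, ℝ), 0 ≤ ∫ x, |f x| ^ p := fun f =>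
    integral_nonneg fun x => by positivity
  have hFM : ∀ l, ∫ x, |F l x| ^ p ≤ (M : ℝ) ^ p := fun l => by
    have := hM l
    rw [hN, ← ENNReal.ofReal_coe_nnreal, ENNReal.ofReal_le_ofReal_iff M.coe_nonneg] at this
    exact (Real.rpow_inv_le_iff_of_pos (hI _) M.coe_nonneg hp0).1 this
  have hdual := integral_abs_rpow_le_of_forall_schwartz hpq h
    (A := C * n * (μ ^ p * M ^ p) / μ) (D := C * n / μ) fun g => by
      have h1 := H (μ • h) g i j (fun l => μ • F l) (by
        have : Δ (μ • h) = μ • Δ h := by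
          simp only [laplacian_eq_sum b, Finset.smul_sum, lineDerivOp_smul]
        simp only [this, hF, Finset.smul_sum, lineDerivOp_smul])
      have h2 : ∀ f : 𝓢(E, ℝ), ∫ x, |(μ • f) x| ^ p = μ ^ p * ∫ x, |f x| ^ p := fun f => by
        rw [← integral_const_mul]
        refine integral_congr_ae (.of_forall fun x => ?_)
        simp only [smul_apply, smul_eq_mul, abs_mul, abs_of_pos hμ]
        rw [Real.mul_rpow hμ.le (abs_nonneg _)]
      have h3 : ∫ x, (μ • h) x * g x = μ * ∫ x, h x * g x := by
        simp only [smul_apply, smul_eq_mul, mul_assoc]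
        exact integral_const_mul _ _
      simp only [h2, h3, abs_mul, abs_of_pos hμ] at h1
      have h4 : ∑ l, (μ ^ p * (∫ x, |F l x| ^ p) + ∫ x, |g x| ^ q) ≤
          n * (μ ^ p * M ^ p + ∫ x, |g x| ^ q) := by
        rw [hn, ← nsmul_eq_mul]
        exact Finset.sum_le_card_nsmul _ _ _ fun l _ => by
          gcongr
          exact hFM l
      have h5 := h1.trans (mul_le_mul_of_nonneg_left h4 hC.le)
      rw [← le_div_iff₀' hμ] at h5
      refine h5.trans_eq ?_
      ring
  have hD : C * n / μ ≤ 1 / 2 := by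
    rw [div_le_iff₀ hμ]
    linarith
  have hbound : ∫ x, |h x| ^ p ≤ (μ * M) ^ p := by
    rw [Real.mul_rpow hμ.le M.coe_nonneg]
    have h1 := mul_le_mul_of_nonneg_right hD (hI h)
    have h2 := mul_le_mul_of_nonneg_right hD (by positivity : 0 ≤ μ ^ p * (M : ℝ) ^ p)
    have h3 : C * n * (μ ^ p * (M : ℝ) ^ p) / μ = C * n / μ * (μ ^ p * (M : ℝ) ^ p) := by ring
    linarith
  rw [hN]
  calc ENNReal.ofReal ((∫ x, |h x| ^ p) ^ p⁻¹) ≤ ENNReal.ofReal (μ * M) :=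
        ENNReal.ofReal_le_ofReal
          ((Real.rpow_inv_le_iff_of_pos (hI h) (by positivity) hp0).2 hbound)
    _ = _ := by
        rw [ENNReal.ofReal_mul hμ.le, ENNReal.ofReal_coe_nnreal]
        rfl

end SecondOrderEstimate

/-- The norm of a multilinear map is controlled by its values on an orthonormal basis. -/
lemma ContinuousMultilinearMap.opNorm_le_sum_orthonormalBasis {ι E F : Type*} [Fintype ι]
    [NormedAddCommGroup E] [InnerProductSpace ℝ E] [NormedAddCommGroup F] [NormedSpace ℝ F]
    (b : OrthonormalBasis ι ℝ E) {n : ℕ} (T : ContinuousMultilinearMap ℝ (fun _ : Fin n => E) F) :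
    ‖T‖ ≤ ∑ γ : Fin n → ι, ‖T fun i => b (γ i)‖ := by
  refine T.opNorm_le_bound (by positivity) fun m => ?_
  have hm : T m = ∑ γ : Fin n → ι, (∏ i, inner ℝ (b (γ i)) (m i)) • T fun i => b (γ i) := by
    classical
    conv_lhs => rw [show m = fun i => ∑ j, inner ℝ (b j) (m i) • b j from
      funext fun i => (b.sum_repr' (m i)).symm]
    rw [T.map_sum]
    exact Finset.sum_congr rfl fun γ _ => T.map_smul_univ _ _
  rw [hm, Finset.sum_mul]
  refine (norm_sum_le _ _).trans (Finset.sum_le_sum fun γ _ => ?_)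
  rw [norm_smul, mul_comm, norm_prod]
  gcongr with i
  simpa using norm_inner_le_norm (𝕜 := ℝ) (b (γ i)) (m i)

section LameSystem

open SchwartzMap LineDeriv Laplacian

variable {E F : Type*} [NormedAddCommGroup E] [InnerProductSpace ℝ E] [NormedAddCommGroup F]
  [NormedSpace ℝ F] {ι : Type} [Fintype ι] (b : OrthonormalBasis ι ℝ E)

lemma SchwartzMap.lineDerivOp_comm (f : 𝓢(E, F)) (v w : E) :
    ∂_{v} (∂_{w} f) = ∂_{w} (∂_{v} f) := by
  have h : ∀ (v w x : E), ∂_{v} (∂_{w} f) x = fderiv ℝ (fderiv ℝ f) x v w := fun v w x => by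
    rw [lineDerivOp_apply_eq_fderiv]
    have hd : DifferentiableAt ℝ (fderiv ℝ f) x :=
      ((f.smooth 2).fderiv_right (m := 1) (by norm_num)).differentiable (by norm_num) x
    have := hd.hasFDerivAt.clm_apply (hasFDerivAt_const w x)
    rw [show (⇑(∂_{w} f : 𝓢(E, F))) = fun y => fderiv ℝ f y w from rfl, this.fderiv]
    simp
  ext x
  rw [h, h]
  exact ((f.smooth 2).contDiffAt.isSymmSndFDerivAt (by simp)) v w

lemma SchwartzMap.lineDerivOp_sub (f g : 𝓢(E, F)) (v : E) :
    ∂_{v} (f - g) = ∂_{v} f - ∂_{v} g :=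
  map_sub (lineDerivOpCLM ℝ 𝓢(E, F) v) f g

variable [FiniteDimensional ℝ E]

lemma SchwartzMap.laplacian_lineDerivOp (f : 𝓢(E, F)) (v : E) :
    Δ (∂_{v} f) = ∂_{v} (Δ f) := by
  simp only [laplacian_eq_sum (stdOrthonormalBasis ℝ E), lineDerivOp_sum, lineDerivOp_comm _ v]

/-- `IsLamePair b α β v Z` means that `v` solves the Lamé system `L v = Z`, in coordinates. -/
def IsLamePair (α β : ℝ) (v Z : ι → 𝓢(E, ℝ)) : Prop :=
  ∀ m, Z m = (-α) • Δ (v m) - (α + β) • ∂_{b m} (∑ i, ∂_{b i} (v i))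

namespace IsLamePair

variable {b} {α β : ℝ} {v Z : ι → 𝓢(E, ℝ)}

lemma lineDerivOp (h : IsLamePair b α β v Z) (w : E) :
    IsLamePair b α β (fun m => ∂_{w} (v m)) (fun m => ∂_{w} (Z m)) := fun m => by
  simp only [h m, SchwartzMap.lineDerivOp_sub, lineDerivOp_smul, laplacian_lineDerivOp,
    lineDerivOp_sum, lineDerivOp_comm _ w]

lemma iteratedLineDerivOp (h : IsLamePair b α β v Z) {n : ℕ} (w : Fin n → E) :
    IsLamePair b α β (fun m => ∂^{w} (v m)) (fun m => ∂^{w} (Z m)) := by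
  induction n with
  | zero => simpa using h
  | succ n ih =>
    simp only [iteratedLineDerivOp_succ_left]
    exact (ih _).lineDerivOp _

/-- The divergence solves a scalar Poisson equation. -/
lemma laplacian_lineDerivOp_div (h : IsLamePair b α β v Z) (hc : 2 * α + β ≠ 0) (i : ι) :
    Δ (∂_{b i} (∑ j, ∂_{b j} (v j))) =
      ∑ j, ∂_{b i} (∂_{b j} ((-(2 * α + β)⁻¹) • Z j)) := by
  have h1 : ∑ j, ∂_{b j} (Z j) = (-(2 * α + β)) • Δ (∑ j, ∂_{b j} (v j)) := by
    have h2 : Δ (∑ j, ∂_{b j} (v j)) = ∑ j, ∂_{b j} (Δ (v j)) := by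
      rw [laplacian_eq_sum b]
      simp only [lineDerivOp_sum, laplacian_eq_sum b]
      rw [Finset.sum_comm]
      exact Finset.sum_congr rfl fun j _ => Finset.sum_congr rfl fun l _ => by
        rw [lineDerivOp_comm _ (b l) (b j), lineDerivOp_comm _ (b l) (b j)]
    have h3 : ∀ j, ∂_{b j} (Z j) = (-α) • ∂_{b j} (Δ (v j)) -
        (α + β) • ∂_{b j} (∂_{b j} (∑ i, ∂_{b i} (v i))) := fun j => by
      rw [h j, SchwartzMap.lineDerivOp_sub, lineDerivOp_smul, lineDerivOp_smul]
    simp only [h3]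
    rw [Finset.sum_sub_distrib, ← Finset.smul_sum, ← Finset.smul_sum, ← h2, ← laplacian_eq_sum b]
    module
  rw [laplacian_lineDerivOp]
  simp only [lineDerivOp_smul]
  rw [← Finset.smul_sum, ← lineDerivOp_sum, h1, lineDerivOp_smul, smul_smul, neg_mul_neg,
    inv_mul_cancel₀ hc, one_smul]

variable [MeasurableSpace E] [BorelSpace E]

/-- The second order `L^p` estimate for the Lamé system, in coordinates. -/
theorem exists_eLpNorm_le [Nontrivial E] (b : OrthonormalBasis ι ℝ E) (hα : 0 < α)
    (hc : 0 < 2 * α + β) {p : ℝ} (hp : 1 < p) :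
    ∃ C : NNReal, ∀ (v Z : ι → 𝓢(E, ℝ)) (M : ENNReal), IsLamePair b α β v Z →
      (∀ m, eLpNorm (Z m) (ENNReal.ofReal p) volume ≤ M) →
      ∀ i j m, eLpNorm (∂_{b i} (∂_{b j} (v m)) : 𝓢(E, ℝ)) (ENNReal.ofReal p) volume ≤ C * M := by
  obtain ⟨C₁, h₁⟩ := exists_eLpNorm_le_of_laplacian_eq_sum b hp ι
  obtain ⟨C₂, h₂⟩ := exists_eLpNorm_le_of_laplacian_eq_sum b hp Unit
  have hsmul : ∀ (c : ℝ) (f : 𝓢(E, ℝ)), eLpNorm (c • f) (ENNReal.ofReal p) volume =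
      ‖c‖₊ * eLpNorm f (ENNReal.ofReal p) volume := fun c f => by
    rw [show (⇑(c • f) : E → ℝ) = c • ⇑f from rfl, eLpNorm_const_smul]
    rfl
  have hp1 : 1 ≤ ENNReal.ofReal p := by simpa using hp.le
  refine ⟨C₂ * (‖α⁻¹‖₊ * (1 + ‖α + β‖₊ * (C₁ * ‖-(2 * α + β)⁻¹‖₊))),
    fun v Z M h hZ i j m => ?_⟩
  have hdiv : eLpNorm (∂_{b m} (∑ i, ∂_{b i} (v i)) : 𝓢(E, ℝ)) (ENNReal.ofReal p) volume ≤
      C₁ * (‖-(2 * α + β)⁻¹‖₊ * M) := by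
    refine h₁ _ (fun _ => m) id _ _ (h.laplacian_lineDerivOp_div hc.ne' m) fun l => ?_
    rw [hsmul]
    gcongr
    exact hZ l
  have hlap : eLpNorm (Δ (v m) : 𝓢(E, ℝ)) (ENNReal.ofReal p) volume ≤
      ‖α⁻¹‖₊ * (M + ‖α + β‖₊ * (C₁ * (‖-(2 * α + β)⁻¹‖₊ * M))) := by
    have e : Δ (v m) = (-α⁻¹) • (Z m + (α + β) • ∂_{b m} (∑ i, ∂_{b i} (v i))) := by
      rw [h m, sub_add_cancel, smul_smul, neg_mul_neg, inv_mul_cancel₀ hα.ne', one_smul]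
    rw [e, hsmul, nnnorm_neg]
    gcongr
    refine (eLpNorm_add_le (Z m).continuous.aestronglyMeasurable
      (SchwartzMap.continuous _).aestronglyMeasurable hp1).trans ?_
    rw [hsmul]
    gcongr
    exact hZ m
  refine (h₂ _ (fun _ => i) (fun _ => j) (fun _ => Δ (v m)) _ ?_ fun _ => hlap).trans_eq ?_
  · rw [laplacian_lineDerivOp, laplacian_lineDerivOp]
    simp
  · push_cast
    ring

end IsLamePair

end LameSystem

section Components

open SchwartzMap LineDeriv Laplacian

section Postcomp

variable {E F G : Type*} [NormedAddCommGroup E] [NormedSpace ℝ E] [NormedAddCommGroup F]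
  [NormedSpace ℝ F] [NormedAddCommGroup G] [NormedSpace ℝ G]

lemma SchwartzMap.lineDerivOp_postcompCLM (L : F →L[ℝ] G) (f : 𝓢(E, F)) (v : E) :
    ∂_{v} (f.postcompCLM L) = (∂_{v} f).postcompCLM L := by
  ext x
  rw [postcompCLM_apply, lineDerivOp_apply_eq_fderiv, lineDerivOp_apply_eq_fderiv,
    show (⇑(f.postcompCLM L) : E → G) = L ∘ f from rfl,
    fderiv_comp x L.differentiableAt f.differentiableAt, L.fderiv]
  rfl

lemma SchwartzMap.iteratedLineDerivOp_postcompCLM (L : F →L[ℝ] G) (f : 𝓢(E, F)) {n : ℕ}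
    (w : Fin n → E) : ∂^{w} (f.postcompCLM L) = (∂^{w} f).postcompCLM L := by
  induction n with
  | zero => simp
  | succ n ih => simp only [iteratedLineDerivOp_succ_left, ih, lineDerivOp_postcompCLM]

end Postcomp

variable {ι : Type} [Fintype ι]

/-- The `m`-th component of a vector-valued Schwartz function. -/
noncomputable def SchwartzMap.component (u : 𝓢(EuclideanSpace ℝ ι, EuclideanSpace ℝ ι)) (m : ι) :
    𝓢(EuclideanSpace ℝ ι, ℝ) :=
  u.postcompCLM (EuclideanSpace.proj m : EuclideanSpace ℝ ι →L[ℝ] ℝ)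

lemma SchwartzMap.iteratedLineDerivOp_component_apply
    (u : 𝓢(EuclideanSpace ℝ ι, EuclideanSpace ℝ ι)) (m : ι) {n : ℕ}
    (w : Fin n → EuclideanSpace ℝ ι) (x : EuclideanSpace ℝ ι) :
    ∂^{w} (u.component m) x = iteratedFDeriv ℝ n u x w m := by
  rw [component, iteratedLineDerivOp_postcompCLM, ← iteratedLineDerivOp_eq_iteratedFDeriv]
  rfl

lemma gradient_apply_eq_fderiv [DecidableEq ι] (f : EuclideanSpace ℝ ι → ℝ)
    (x : EuclideanSpace ℝ ι) (m : ι) :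
    gradient f x m = fderiv ℝ f x (EuclideanSpace.single m 1) := by
  have h := InnerProductSpace.toDual_symm_apply (𝕜 := ℝ) (x := EuclideanSpace.single m 1)
    (y := fderiv ℝ f x)
  rw [← h, gradient, EuclideanSpace.inner_single_right, one_mul]
  rfl

/-- The Lamé operator maps Schwartz functions to Schwartz functions. -/
theorem exists_schwartzMap_eq_lameOp (α β : ℝ)
    (u : 𝓢(EuclideanSpace ℝ (Fin 3), EuclideanSpace ℝ (Fin 3))) :
    ∃ Z : 𝓢(EuclideanSpace ℝ (Fin 3), EuclideanSpace ℝ (Fin 3)), ⇑Z = lameOp α β u ∧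
      IsLamePair (EuclideanSpace.basisFun (Fin 3) ℝ) α β u.component Z.component := by
  set b := EuclideanSpace.basisFun (Fin 3) ℝ
  have hb : ∀ i, b i = EuclideanSpace.single i 1 := EuclideanSpace.basisFun_apply _ _
  let z : Fin 3 → 𝓢(EuclideanSpace ℝ (Fin 3), ℝ) := fun m =>
    (-α) • Δ (u.component m) - (α + β) • ∂_{b m} (∑ i, ∂_{b i} (u.component i))
  let Z : 𝓢(EuclideanSpace ℝ (Fin 3), EuclideanSpace ℝ (Fin 3)) :=
    ∑ m, (z m).postcompCLM (ContinuousLinearMap.toSpanSingleton ℝ (b m))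
  have hZz : ∀ m, Z.component m = z m := fun m => by
    ext x
    simp [component, Z, sum_apply, hb]
  refine ⟨Z, funext fun x => ?_, hZz⟩
  ext m
  have hZ : Z x m = z m x := by rw [← hZz m]; rfl
  have hlap : ∀ j, ∂_{b j} (∂_{b j} (u.component m)) x =
      iteratedFDeriv ℝ 2 u x (fun _ => EuclideanSpace.single j 1) m := fun j => by
    rw [← iteratedLineDerivOp_component_apply, ← hb]
    rfl
  have hdiv : ⇑(∑ i, ∂_{b i} (u.component i) : 𝓢(EuclideanSpace ℝ (Fin 3), ℝ)) =
      fun y => ∑ i : Fin 3, fderiv ℝ u y (EuclideanSpace.single i 1) i := funext fun y => by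
    rw [sum_apply]
    refine Finset.sum_congr rfl fun i _ => ?_
    rw [component, lineDerivOp_postcompCLM, hb]
    rfl
  rw [hZ, lameOp, PiLp.sub_apply, PiLp.smul_apply, PiLp.smul_apply, gradient_apply_eq_fderiv,
    ← hdiv, ← hb, ← lineDerivOp_apply_eq_fderiv, sub_apply, smul_apply, smul_apply,
    laplacian_eq_sum b, sum_apply]
  simp [hlap]

end Components

/-- Lemma 2.5 of the paper: Calderón–Zygmund-type estimate for the strongly
elliptic Lamé operator: `‖∇^{k+2} u‖_{L^q} ≤ C ‖∇^k (Lu)‖_{L^q}` for Schwartz `u`. -/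
theorem lame_elliptic_estimate
    (α β : ℝ) (hα : 0 < α) (hαβ : 0 ≤ 2 * α + 3 * β)
    (q : ℝ) (hq1 : 1 < q) (k : ℕ) :
    ∃ C : ℝ, 0 < C ∧
      ∀ u : SchwartzMap (EuclideanSpace ℝ (Fin 3)) (EuclideanSpace ℝ (Fin 3)),
        eLpNorm (fun x => iteratedFDeriv ℝ (k + 2) (⇑u) x)
            (ENNReal.ofReal q) volume ≤
          ENNReal.ofReal C *
            eLpNorm (fun x => iteratedFDeriv ℝ k (lameOp α β ⇑u) x)
              (ENNReal.ofReal q) volume := by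
  set b := EuclideanSpace.basisFun (Fin 3) ℝ
  obtain ⟨C, hC⟩ := IsLamePair.exists_eLpNorm_le b hα (by linarith : 0 < 2 * α + β) hq1
  have hq : 1 ≤ ENNReal.ofReal q := by simpa using hq1.le
  set N : ℕ := Fintype.card ((Fin (k + 2) → Fin 3) × Fin 3)
  refine ⟨N * C + 1, by positivity, fun u => ?_⟩
  obtain ⟨Z, hZ, hpair⟩ := exists_schwartzMap_eq_lameOp α β u
  rw [← hZ]
  set M := eLpNorm (fun x => iteratedFDeriv ℝ k (⇑Z) x) (ENNReal.ofReal q) volume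
  have hZM : ∀ (γ : Fin k → Fin 3) (m : Fin 3),
      eLpNorm (LineDeriv.iteratedLineDerivOp (fun i => b (γ i)) (Z.component m))
        (ENNReal.ofReal q) volume ≤ M := fun γ m => by
    refine eLpNorm_mono fun x => ?_
    rw [SchwartzMap.iteratedLineDerivOp_component_apply]
    refine (PiLp.norm_apply_le _ m).trans
      ((ContinuousMultilinearMap.le_opNorm _ _).trans_eq ?_)
    simp
  have hu : ∀ a : (Fin (k + 2) → Fin 3) × Fin 3,
      eLpNorm (LineDeriv.iteratedLineDerivOp (fun i => b (a.1 i)) (u.component a.2))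
        (ENNReal.ofReal q) volume ≤ C * M := fun ⟨γ, m⟩ =>
    hC _ _ M (hpair.iteratedLineDerivOp fun i => b (γ i.succ.succ))
      (fun m => hZM (fun i => γ i.succ.succ) m) (γ 0) (γ 1) m
  have hpt : ∀ x, ‖iteratedFDeriv ℝ (k + 2) u x‖ ≤ ∑ a : (Fin (k + 2) → Fin 3) × Fin 3,
      ‖LineDeriv.iteratedLineDerivOp (fun i => b (a.1 i)) (u.component a.2) x‖ := fun x => by
    refine (ContinuousMultilinearMap.opNorm_le_sum_orthonormalBasis b _).trans ?_
    rw [Fintype.sum_prod_type]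
    refine Finset.sum_le_sum fun γ _ => ?_
    simp only [SchwartzMap.iteratedLineDerivOp_component_apply]
    generalize iteratedFDeriv ℝ (k + 2) u x (fun i => b (γ i)) = y
    conv_lhs => rw [← b.sum_repr y]
    refine (norm_sum_le _ _).trans_eq (Finset.sum_congr rfl fun m _ => ?_)
    simp [b, norm_smul]
  calc _ ≤ eLpNorm (∑ a : (Fin (k + 2) → Fin 3) × Fin 3, fun x =>
        ‖LineDeriv.iteratedLineDerivOp (fun i => b (a.1 i)) (u.component a.2) x‖)
        (ENNReal.ofReal q) volume := by
        refine eLpNorm_mono_real fun x => ?_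
        rw [Finset.sum_apply]
        exact hpt x
    _ ≤ ∑ a : (Fin (k + 2) → Fin 3) × Fin 3, C * M := by
        refine (eLpNorm_sum_le (fun a _ =>
          (SchwartzMap.continuous _).norm.aestronglyMeasurable) hq).trans
          (Finset.sum_le_sum fun a _ => ?_)
        rw [eLpNorm_norm]
        exact hu a
    _ = ENNReal.ofReal (N * C) * M := by
        rw [Finset.sum_const, nsmul_eq_mul, ENNReal.ofReal_mul (Nat.cast_nonneg _),
          ENNReal.ofReal_natCast, ENNReal.ofReal_coe_nnreal, mul_assoc]
        rfl
    _ ≤ ENNReal.ofReal (N * C + 1) * M := by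
        gcongr
        simp
end

section
/- Let Ω ⊆ ℝ × ℝ³ be open, let A > 0, γ > 1, α > 0, β ∈ ℝ, and δ ∈ (0,1) ∪ (1,∞). Let ρ : Ω → ℝ be positive and continuously differentiable, and u : Ω → ℝ³ be twice continuously differentiable, satisfying at every point of Ω the continuity equation ∂_t ρ + div(ρ·u) = 0 and the momentum equations ∂_t(ρ·u) + div(ρ·u⊗u) + ∇P = div 𝕋, where P = A·ρ^γ, 𝕋 = α·ρ^δ·(∇u + (∇u)ᵀ) + β·ρ^δ·(div u)·I₃, and div 𝕋 is the row-wise spatial divergence of the matrix field 𝕋. Then at every point of Ω, ∂_t u + (u·∇)u + (Aγ/(γ−1))·∇(ρ^{γ−1}) + ρ^{δ−1}·Lu = Q(u)·ψ, where Lu = −α·Δu − (α+β)·∇(div u), Q(u) = α·(∇u + (∇u)ᵀ) + β·(div u)·I₃, ψ = (δ/(δ−1))·∇(ρ^{δ−1}), and Q(u)·ψ denotes the vector with i-th component ∑_j Q(u)_{ij}·ψ^{(j)}. -/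
open MeasureTheory

/-- Partial derivative in the time variable of a scalar function on `ℝ × ℝ³`. -/
noncomputable def timeDeriv (f : ℝ × EuclideanSpace ℝ (Fin 3) → ℝ)
    (p : ℝ × EuclideanSpace ℝ (Fin 3)) : ℝ :=
  fderiv ℝ f p (1, 0)

/-- Partial derivative in the `j`-th spatial variable of a scalar function on `ℝ × ℝ³`. -/
noncomputable def spaceDeriv (f : ℝ × EuclideanSpace ℝ (Fin 3) → ℝ)
    (p : ℝ × EuclideanSpace ℝ (Fin 3)) (j : Fin 3) : ℝ :=
  fderiv ℝ f p (0, EuclideanSpace.single j 1)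

section DerivativeRules

variable {f g : ℝ × EuclideanSpace ℝ (Fin 3) → ℝ} {p : ℝ × EuclideanSpace ℝ (Fin 3)}

theorem timeDeriv_mul (hf : DifferentiableAt ℝ f p) (hg : DifferentiableAt ℝ g p) :
    timeDeriv (fun q => f q * g q) p = f p * timeDeriv g p + g p * timeDeriv f p := by
  simp [timeDeriv, fderiv_fun_mul hf hg]

theorem spaceDeriv_mul (hf : DifferentiableAt ℝ f p) (hg : DifferentiableAt ℝ g p) (j : Fin 3) :
    spaceDeriv (fun q => f q * g q) p j = f p * spaceDeriv g p j + g p * spaceDeriv f p j := by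
  simp [spaceDeriv, fderiv_fun_mul hf hg]

theorem spaceDeriv_add (hf : DifferentiableAt ℝ f p) (hg : DifferentiableAt ℝ g p) (j : Fin 3) :
    spaceDeriv (fun q => f q + g q) p j = spaceDeriv f p j + spaceDeriv g p j := by
  simp [spaceDeriv, fderiv_fun_add hf hg]

theorem spaceDeriv_const_mul (hf : DifferentiableAt ℝ f p) (c : ℝ) (j : Fin 3) :
    spaceDeriv (fun q => c * f q) p j = c * spaceDeriv f p j := by
  simp [spaceDeriv, (hf.hasFDerivAt.const_mul c).fderiv]

theorem spaceDeriv_mul_const (hf : DifferentiableAt ℝ f p) (c : ℝ) (j : Fin 3) :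
    spaceDeriv (fun q => f q * c) p j = spaceDeriv f p j * c := by
  simpa only [mul_comm c] using spaceDeriv_const_mul hf c j

theorem spaceDeriv_sum {F : Fin 3 → ℝ × EuclideanSpace ℝ (Fin 3) → ℝ}
    (hF : ∀ l, DifferentiableAt ℝ (F l) p) (j : Fin 3) :
    spaceDeriv (fun q => ∑ l, F l q) p j = ∑ l, spaceDeriv (F l) p j := by
  simp [spaceDeriv, fderiv_fun_sum fun l _ => hF l]

theorem spaceDeriv_rpow (hf : DifferentiableAt ℝ f p) (hp : 0 < f p) (a : ℝ) (j : Fin 3) :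
    spaceDeriv (fun q => f q ^ a) p j = a * f p ^ (a - 1) * spaceDeriv f p j := by
  simp [spaceDeriv, (hf.hasFDerivAt.rpow_const (Or.inl hp.ne')).fderiv]

theorem div_mul_spaceDeriv_rpow_sub_one (hf : DifferentiableAt ℝ f p) (hp : 0 < f p) {a : ℝ}
    (ha : a ≠ 1) (c : ℝ) (j : Fin 3) :
    c / (a - 1) * spaceDeriv (fun q => f q ^ (a - 1)) p j
      = c * f p ^ (a - 2) * spaceDeriv f p j := by
  have ha' : a - 1 ≠ 0 := sub_ne_zero.2 ha
  rw [spaceDeriv_rpow hf hp, show a - 1 - 1 = a - 2 by ring]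
  field_simp

theorem differentiableAt_spaceDeriv (hf : ContDiffAt ℝ 2 f p) (j : Fin 3) :
    DifferentiableAt ℝ (fun q => spaceDeriv f q j) p :=
  ((hf.fderiv_right (m := 1) (by norm_num)).differentiableAt (by norm_num)).clm_apply
    (differentiableAt_const _)

theorem spaceDeriv_comm (hf : ContDiffAt ℝ 2 f p) (i j : Fin 3) :
    spaceDeriv (fun q => spaceDeriv f q i) p j = spaceDeriv (fun q => spaceDeriv f q j) p i := by
  have hd : DifferentiableAt ℝ (fderiv ℝ f) p :=
    (hf.fderiv_right (m := 1) (by norm_num)).differentiableAt (by norm_num)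
  simp only [spaceDeriv]
  rw [fderiv_clm_apply hd (differentiableAt_const _), fderiv_clm_apply hd (differentiableAt_const _)]
  simpa using (hf.isSymmSndFDerivAt (by simp)).eq _ _

end DerivativeRules

/-- reformulation (1.7)–(1.8) of the paper: a positive `C¹` density `ρ` and
a `C²` velocity `u` solving the isentropic compressible Navier–Stokes equations with
degenerate viscosities `μ(ρ) = α ρ^δ`, `λ(ρ) = β ρ^δ` on an open set `Ω ⊆ ℝ × ℝ³` satisfy
`∂ₜu + (u·∇)u + (Aγ/(γ-1))∇(ρ^{γ-1}) + ρ^{δ-1} Lu = Q(u)·ψ` on `Ω`, where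
`Lu = -αΔu - (α+β)∇(div u)`, `Q(u) = α(∇u + (∇u)ᵀ) + β(div u) I₃` and
`ψ = (δ/(δ-1))∇(ρ^{δ-1})`, written componentwise. -/
theorem degenerate_navier_stokes_reformulation
    (Ω : Set (ℝ × EuclideanSpace ℝ (Fin 3))) (hΩ : IsOpen Ω)
    (A γ α β δ : ℝ) (hA : 0 < A) (hγ : 1 < γ) (hα : 0 < α)
    (hδ : δ ∈ Set.Ioo (0 : ℝ) 1 ∪ Set.Ioi (1 : ℝ))
    (ρ : ℝ × EuclideanSpace ℝ (Fin 3) → ℝ)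
    (u : ℝ × EuclideanSpace ℝ (Fin 3) → EuclideanSpace ℝ (Fin 3))
    (hρpos : ∀ p ∈ Ω, 0 < ρ p)
    (hρ : ContDiffOn ℝ 1 ρ Ω) (hu : ContDiffOn ℝ 2 u Ω)
    -- continuity equation `∂ₜρ + div(ρu) = 0` on `Ω`
    (hcont : ∀ p ∈ Ω,
      timeDeriv ρ p + ∑ j : Fin 3, spaceDeriv (fun q => ρ q * u q j) p j = 0)
    -- momentum equations `∂ₜ(ρu) + div(ρ u⊗u) + ∇P = div 𝕋` on `Ω`, componentwise, with
    -- `P = A ρ^γ` and `𝕋ᵢⱼ = α ρ^δ (∂ⱼuⁱ + ∂ᵢuʲ) + β ρ^δ (div u) δᵢⱼ`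
    (hmom : ∀ p ∈ Ω, ∀ i : Fin 3,
      timeDeriv (fun q => ρ q * u q i) p
        + (∑ j : Fin 3, spaceDeriv (fun q => ρ q * u q i * u q j) p j)
        + spaceDeriv (fun q => A * ρ q ^ γ) p i
      = ∑ j : Fin 3, spaceDeriv (fun q =>
          α * ρ q ^ δ * (spaceDeriv (fun r => u r i) q j
              + spaceDeriv (fun r => u r j) q i)
            + β * ρ q ^ δ * (∑ l : Fin 3, spaceDeriv (fun r => u r l) q l)
              * (if i = j then (1 : ℝ) else 0)) p j) :
    -- conclusion: `∂ₜu + (u·∇)u + (Aγ/(γ-1))∇(ρ^{γ-1}) + ρ^{δ-1} Lu = Q(u)·ψ` on `Ω`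
    ∀ p ∈ Ω, ∀ i : Fin 3,
      timeDeriv (fun q => u q i) p
        + (∑ j : Fin 3, u p j * spaceDeriv (fun q => u q i) p j)
        + (A * γ / (γ - 1)) * spaceDeriv (fun q => ρ q ^ (γ - 1)) p i
        + ρ p ^ (δ - 1) *
            ((-α) * (∑ j : Fin 3,
                spaceDeriv (fun q => spaceDeriv (fun r => u r i) q j) p j)
              - (α + β) *
                spaceDeriv (fun q => ∑ l : Fin 3, spaceDeriv (fun r => u r l) q l) p i)
      = ∑ j : Fin 3,
          (α * (spaceDeriv (fun q => u q i) p j + spaceDeriv (fun q => u q j) p i)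
            + β * (∑ l : Fin 3, spaceDeriv (fun r => u r l) p l)
              * (if i = j then (1 : ℝ) else 0))
          * ((δ / (δ - 1)) * spaceDeriv (fun q => ρ q ^ (δ - 1)) p j) := by
  intro p hp i
  have hΩp : Ω ∈ nhds p := hΩ.mem_nhds hp
  have hr : 0 < ρ p := hρpos p hp
  have dρ : DifferentiableAt ℝ ρ p := (hρ.contDiffAt hΩp).differentiableAt (by norm_num)
  have cu (k : Fin 3) : ContDiffAt ℝ 2 (fun q => u q k) p :=
    contDiffAt_euclidean.1 (hu.contDiffAt hΩp) k
  have du (k : Fin 3) : DifferentiableAt ℝ (fun q => u q k) p :=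
    (cu k).differentiableAt (by norm_num)
  have ddu (k j : Fin 3) : DifferentiableAt ℝ (fun q => spaceDeriv (fun r => u r k) q j) p :=
    differentiableAt_spaceDeriv (cu k) j
  have dpow (a : ℝ) : DifferentiableAt ℝ (fun q => ρ q ^ a) p :=
    dρ.rpow_const (Or.inl hr.ne')
  have ddiv : DifferentiableAt ℝ (fun q => ∑ l : Fin 3, spaceDeriv (fun r => u r l) q l) p :=
    DifferentiableAt.fun_sum fun l _ => ddu l l
  have hδ1 : δ ≠ 1 := by
    rcases hδ with h | h
    · exact h.2.ne
    · exact (Set.mem_Ioi.1 h).ne'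
  have convective (j : Fin 3) : spaceDeriv (fun q => ρ q * u q i * u q j) p j
      = u p i * spaceDeriv (fun q => ρ q * u q j) p j
        + ρ p * (u p j * spaceDeriv (fun q => u q i) p j) := by
    rw [spaceDeriv_mul (dρ.fun_mul (du i)) (du j), spaceDeriv_mul dρ (du i), spaceDeriv_mul dρ (du j)]
    ring
  have pow_pred (a : ℝ) : ρ p ^ (a - 1) = ρ p * ρ p ^ (a - 2) := by
    rw [show a - 1 = 1 + (a - 2) by ring, Real.rpow_add hr, Real.rpow_one]
  have pow_eq (a : ℝ) : ρ p ^ a = ρ p * (ρ p * ρ p ^ (a - 2)) := by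
    rw [← pow_pred, Real.rpow_sub_one hr.ne', mul_div_cancel₀ _ hr.ne']
  have stress (j : Fin 3) : spaceDeriv (fun q =>
        α * ρ q ^ δ * (spaceDeriv (fun r => u r i) q j + spaceDeriv (fun r => u r j) q i)
          + β * ρ q ^ δ * (∑ l : Fin 3, spaceDeriv (fun r => u r l) q l)
            * (if i = j then (1 : ℝ) else 0)) p j
      = ρ p * ((α * (spaceDeriv (fun q => u q i) p j + spaceDeriv (fun q => u q j) p i)
            + β * (∑ l : Fin 3, spaceDeriv (fun r => u r l) p l)
              * (if i = j then (1 : ℝ) else 0)) * (δ * ρ p ^ (δ - 2) * spaceDeriv ρ p j)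
          + ρ p ^ (δ - 1) *
            (α * (spaceDeriv (fun q => spaceDeriv (fun r => u r i) q j) p j
                + spaceDeriv (fun q => spaceDeriv (fun r => u r j) q j) p i)
              + β * (if i = j then
                  spaceDeriv (fun q => ∑ l : Fin 3, spaceDeriv (fun r => u r l) q l) p j
                else 0))) := by
    rw [spaceDeriv_add (((dpow δ).const_mul α).fun_mul ((ddu i j).fun_add (ddu j i)))
        ((((dpow δ).const_mul β).fun_mul ddiv).mul_const _),
      spaceDeriv_mul ((dpow δ).const_mul α) ((ddu i j).fun_add (ddu j i)),
      spaceDeriv_mul_const (((dpow δ).const_mul β).fun_mul ddiv),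
      spaceDeriv_mul ((dpow δ).const_mul β) ddiv, spaceDeriv_add (ddu i j) (ddu j i),
      spaceDeriv_const_mul (dpow δ), spaceDeriv_const_mul (dpow δ), spaceDeriv_rpow dρ hr,
      spaceDeriv_comm (cu j) i j, pow_pred, pow_eq δ]
    split_ifs <;> ring
  have hm := hmom p hp i
  have hc := hcont p hp
  rw [timeDeriv_mul dρ (du i), spaceDeriv_const_mul (dpow γ), spaceDeriv_rpow dρ hr,
    pow_pred] at hm
  simp only [convective, stress, ← Finset.mul_sum, Finset.sum_add_distrib, Finset.sum_ite_eq,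
    Finset.mem_univ, if_true] at hm
  simp only [div_mul_spaceDeriv_rpow_sub_one dρ hr hγ.ne',
    div_mul_spaceDeriv_rpow_sub_one dρ hr hδ1]
  have hdiv := spaceDeriv_sum (fun l => ddu l l) i
  rw [← hdiv] at hm
  apply mul_left_cancel₀ hr.ne'
  linear_combination hm - u p i * hc
end
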